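/- arXiv:1510.06394 — 2 statements merged into one kernel-verified Lean document; each statement's English description precedes it below -/
import Mathlib

section
/- Let Ω ⊂ ℝⁿ be a bounded open set and F uniformly elliptic with constants 0 < λ ≤ Λ. Let φ ∈ C(Ω), and let u : Ω → ℝ be bounded, lower semicontinuous, satisfy u ≥ φ in Ω, be a viscosity supersolution of F(D²u) ≤ 0 in Ω, and be a continuous viscosity solution of F(D²u) = 0 in the open set {u > φ}. If the restriction of u to the contact set {u = φ} is continuous, then u is continuous in Ω; in particular u does not jump across the free boundary ∂{u > φ} ∩ Ω. -/
open MeasureTheory Metric Set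
open scoped RealInnerProductSpace

noncomputable section

/-- Euclidean space ℝⁿ. -/
abbrev Euc (n : ℕ) := EuclideanSpace ℝ (Fin n)

/-- The operator norm of an `n × n` real matrix, viewed as a linear map on ℝⁿ. -/
def opNorm {n : ℕ} (A : Matrix (Fin n) (Fin n) ℝ) : ℝ :=
  ‖Matrix.toEuclideanCLM (𝕜 := ℝ) A‖

/-- The Hessian matrix `D²u(x)` of `u : ℝⁿ → ℝ` at `x`. -/
def hess2 {n : ℕ} (u : Euc n → ℝ) (x : Euc n) : Matrix (Fin n) (Fin n) ℝ :=
  fun i j => iteratedFDeriv ℝ 2 u x ![EuclideanSpace.single i 1, EuclideanSpace.single j 1]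

/-- `F` is uniformly elliptic with ellipticity constants `0 < lb ≤ ub`:
`lb‖P‖ ≤ F(A+P) − F(A) ≤ ub‖P‖` for all symmetric `A` and positive semidefinite `P`. -/
def UniformlyElliptic {n : ℕ} (F : Matrix (Fin n) (Fin n) ℝ → ℝ) (lb ub : ℝ) : Prop :=
  ∀ (A P : Matrix (Fin n) (Fin n) ℝ), A.IsSymm → P.PosSemidef →
    lb * opNorm P ≤ F (A + P) - F A ∧ F (A + P) - F A ≤ ub * opNorm P

/-- `u` is a viscosity supersolution of `F(D²u) ≤ 0` in `U`: every C² test function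
touching `u` from below at a point of `U` satisfies `F(D²ψ(x₀)) ≤ 0`. -/
def ViscSupersol {n : ℕ} (F : Matrix (Fin n) (Fin n) ℝ → ℝ) (U : Set (Euc n))
    (u : Euc n → ℝ) : Prop :=
  ∀ x₀ ∈ U, ∀ ψ : Euc n → ℝ, ContDiff ℝ 2 ψ → ψ x₀ = u x₀ →
    (∀ᶠ x in nhds x₀, ψ x ≤ u x) → F (hess2 ψ x₀) ≤ 0

/-- `u` is a viscosity subsolution of `F(D²u) ≥ 0` in `U`: every C² test function
touching `u` from above at a point of `U` satisfies `F(D²ψ(x₀)) ≥ 0`. -/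
def ViscSubsol {n : ℕ} (F : Matrix (Fin n) (Fin n) ℝ → ℝ) (U : Set (Euc n))
    (u : Euc n → ℝ) : Prop :=
  ∀ x₀ ∈ U, ∀ ψ : Euc n → ℝ, ContDiff ℝ 2 ψ → ψ x₀ = u x₀ →
    (∀ᶠ x in nhds x₀, u x ≤ ψ x) → 0 ≤ F (hess2 ψ x₀)

/-- `u` solves the fully nonlinear obstacle problem in `Ω` with obstacle `φ`:
`u ∈ C(Ω)`, `u ≥ φ` in `Ω`, `u` is a viscosity supersolution of `F(D²u) ≤ 0` in `Ω`
and a viscosity solution of `F(D²u) = 0` in the non-contact set `{u > φ}`. -/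
def SolvesObstacle {n : ℕ} (F : Matrix (Fin n) (Fin n) ℝ → ℝ) (Ω : Set (Euc n))
    (u φ : Euc n → ℝ) : Prop :=
  ContinuousOn u Ω ∧ (∀ x ∈ Ω, φ x ≤ u x) ∧ ViscSupersol F Ω u ∧
  ViscSupersol F {x ∈ Ω | φ x < u x} u ∧ ViscSubsol F {x ∈ Ω | φ x < u x} u

/-- A modulus: `ω : [0,∞) → [0,∞)` nondecreasing with `ω(0) = 0`. -/
def IsModulus (ω : ℝ → ℝ) : Prop :=
  ω 0 = 0 ∧ MonotoneOn ω (Ici 0) ∧ ∀ r, 0 ≤ r → 0 ≤ ω r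

/-- `φ` is semiconvex on `Ω` with modulus of semiconvexity `ω`: at every `x₀ ∈ Ω` there is
a slope `p` with `φ(x) ≥ φ(x₀) + ⟨p, x − x₀⟩ − ω(|x − x₀|)` on `Ω`. -/
def SemiconvexWithModulus {n : ℕ} (Ω : Set (Euc n)) (φ : Euc n → ℝ) (ω : ℝ → ℝ) : Prop :=
  ∀ x₀ ∈ Ω, ∃ p : Euc n, ∀ x ∈ Ω, φ x₀ + ⟪p, x - x₀⟫ - ω ‖x - x₀‖ ≤ φ x

/-- `p` is the slope of a linear part of `φ` at `x₀` (for modulus `ω`). -/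
def IsLinearPartSlope {n : ℕ} (Ω : Set (Euc n)) (φ : Euc n → ℝ) (ω : ℝ → ℝ)
    (x₀ : Euc n) (p : Euc n) : Prop :=
  ∀ x ∈ Ω, φ x₀ + ⟪p, x - x₀⟫ - ω ‖x - x₀‖ ≤ φ x

/-- `g` is semiconcave with modulus `ω` on `s`. -/
def SemiconcaveWithModulus {n : ℕ} (s : Set (Euc n)) (g : Euc n → ℝ) (ω : ℝ → ℝ) : Prop :=
  ∀ x h : Euc n, x ∈ s → x + h ∈ s → x - h ∈ s →
    g (x + h) + g (x - h) - 2 * g x ≤ ω ‖h‖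

/-- Componentwise order `x ≤ y` on ℝⁿ (`y − x` in the positive cone). -/
def coneLE {n : ℕ} (x y : Euc n) : Prop := ∀ i, x i ≤ y i

/-- The intervention operator `Mu(x) = φ(x) + inf{ u(y) : y ∈ D, y ≥ x }`. -/
def Mop {n : ℕ} (D : Set (Euc n)) (φ u : Euc n → ℝ) (x : Euc n) : ℝ :=
  φ x + sInf (u '' {y ∈ D | coneLE x y})

/-- A bounded domain with `C^{2,α}` boundary, via a global `C^{2,α}` defining function. -/
def IsC2AlphaDomain {n : ℕ} (Ω : Set (Euc n)) (α : ℝ) : Prop :=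
  ∃ ρ : Euc n → ℝ, ContDiff ℝ 2 ρ ∧ Ω = {x | ρ x < 0} ∧
    (∀ x ∈ frontier Ω, fderiv ℝ ρ x ≠ 0) ∧
    ∃ C : ℝ, 0 ≤ C ∧ ∀ x y : Euc n,
      ‖iteratedFDeriv ℝ 2 ρ x - iteratedFDeriv ℝ 2 ρ y‖ ≤ C * ‖x - y‖ ^ α

/-- `u` is a continuous viscosity solution of the fully nonlinear stochastic impulse
control problem on `Ω` with obstacle `Mu` built from `φ`: `u ∈ C(Ω̄)`, `u ≤ Mu` in `Ω`,
`u` is a viscosity subsolution of `F(D²u) ≥ 0` in `Ω`, a viscosity solution of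
`F(D²u) = 0` in `{u < Mu}`, `u = 0` on `∂Ω` and `u ≤ 0` on `Ω̄`. -/
def SolvesImpulse {n : ℕ} (F : Matrix (Fin n) (Fin n) ℝ → ℝ) (Ω : Set (Euc n))
    (u φ : Euc n → ℝ) : Prop :=
  ContinuousOn u (closure Ω) ∧
  (∀ x ∈ Ω, u x ≤ Mop (closure Ω) φ u x) ∧
  ViscSubsol F Ω u ∧
  ViscSubsol F {x ∈ Ω | u x < Mop (closure Ω) φ u x} u ∧
  ViscSupersol F {x ∈ Ω | u x < Mop (closure Ω) φ u x} u ∧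
  (∀ x ∈ frontier Ω, u x = 0) ∧ (∀ x ∈ closure Ω, u x ≤ 0)

/-- `w` is a supersolution on `U` in the weak sense of Pucci: it cannot be touched from below
at a point of `U` by a quadratic polynomial with Hessian `β e eᵀ - γ I` and `κ γ < β ‖e‖²`. -/
def QuadSupersol {n : ℕ} (κ : ℝ) (U : Set (Euc n)) (w : Euc n → ℝ) : Prop :=
  ∀ x₀ ∈ U, ∀ (p e : Euc n) (β γ : ℝ), 0 ≤ γ → κ * γ < β * ‖e‖ ^ 2 →
    ¬ ∀ᶠ x in nhds x₀,
      w x₀ + ⟪p, x - x₀⟫ + β / 2 * ⟪e, x - x₀⟫ ^ 2 - γ / 2 * ‖x - x₀‖ ^ 2 ≤ w x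

theorem QuadSupersol.mono {n : ℕ} {κ : ℝ} {U V : Set (Euc n)} {w : Euc n → ℝ}
    (h : QuadSupersol κ U w) (hVU : V ⊆ U) : QuadSupersol κ V w :=
  fun x hx => h x (hVU hx)

theorem QuadSupersol.add_const {n : ℕ} {κ : ℝ} {U : Set (Euc n)} {w : Euc n → ℝ}
    (h : QuadSupersol κ U w) (b : ℝ) : QuadSupersol κ U (fun x => w x + b) := by
  intro x₀ hx₀ p e β γ hγ hβ hev
  refine h x₀ hx₀ p e β γ hγ hβ (hev.mono fun x hx => ?_)
  dsimp only at hx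
  linarith

/-- The quadratic polynomial with value `c`, gradient `p` and Hessian `β e eᵀ - γ I` at `x₀`. -/
def quadPoly {n : ℕ} (x₀ : Euc n) (c : ℝ) (p e : Euc n) (β γ : ℝ) (x : Euc n) : ℝ :=
  c + ⟪p, x - x₀⟫ + β / 2 * ⟪e, x - x₀⟫ ^ 2 - γ / 2 * ‖x - x₀‖ ^ 2

theorem contDiff_quadPoly {n : ℕ} (x₀ : Euc n) (c : ℝ) (p e : Euc n) (β γ : ℝ) :
    ContDiff ℝ 2 (quadPoly x₀ c p e β γ) := by
  unfold quadPoly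
  have h : ContDiff ℝ 2 (fun x : Euc n => x - x₀) := contDiff_id.sub contDiff_const
  exact ((contDiff_const.add (contDiff_const.inner ℝ h)).add
    (contDiff_const.mul ((contDiff_const.inner ℝ h).pow 2))).sub
    (contDiff_const.mul (h.norm_sq ℝ))

theorem quadPoly_self {n : ℕ} (x₀ : Euc n) (c : ℝ) (p e : Euc n) (β γ : ℝ) :
    quadPoly x₀ c p e β γ x₀ = c := by
  simp [quadPoly]

theorem fderiv_quadPoly {n : ℕ} (x₀ : Euc n) (c : ℝ) (p e : Euc n) (β γ : ℝ) :
    fderiv ℝ (quadPoly x₀ c p e β γ) = fun x =>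
      innerSL ℝ p + (β * ⟪e, x - x₀⟫) • innerSL ℝ e - γ • innerSL ℝ (x - x₀) := by
  funext x
  refine HasFDerivAt.fderiv ?_
  have hsub : HasFDerivAt (fun x : Euc n => x - x₀) (ContinuousLinearMap.id ℝ (Euc n)) x :=
    (hasFDerivAt_id x).sub_const x₀
  have hin : ∀ q : Euc n, HasFDerivAt (fun x : Euc n => ⟪q, x - x₀⟫) (innerSL ℝ q) x := by
    intro q
    have := (innerSL ℝ q).hasFDerivAt.comp x hsub
    simpa [Function.comp_def] using this
  have h := (((hasFDerivAt_const c x).add (hin p)).add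
    (((hin e).pow 2).const_mul (β / 2))).sub ((hsub.norm_sq).const_mul (γ / 2))
  refine HasFDerivAt.congr_fderiv h ?_
  ext v
  simp
  ring

theorem hess2_quadPoly {n : ℕ} (x₀ : Euc n) (c : ℝ) (p e : Euc n) (β γ : ℝ) :
    hess2 (quadPoly x₀ c p e β γ) x₀ =
      β • Matrix.vecMulVec (fun i => e i) (fun i => e i) - γ • (1 : Matrix (Fin n) (Fin n) ℝ) := by
  ext i j
  have hsub : HasFDerivAt (fun x : Euc n => x - x₀) (ContinuousLinearMap.id ℝ (Euc n)) x₀ :=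
    (hasFDerivAt_id x₀).sub_const x₀
  have hin : HasFDerivAt (fun x : Euc n => ⟪e, x - x₀⟫) (innerSL ℝ e) x₀ := by
    have := (innerSL ℝ e).hasFDerivAt.comp x₀ hsub
    simpa [Function.comp_def] using this
  have h2 : HasFDerivAt (fun x : Euc n => innerSL ℝ (x - x₀)) (innerSL ℝ : Euc n →L[ℝ] _) x₀ := by
    have := (innerSL ℝ : Euc n →L[ℝ] _).hasFDerivAt.comp x₀ hsub
    simpa [Function.comp_def] using this
  have h := ((hasFDerivAt_const (innerSL ℝ p) x₀).add
    ((hin.const_mul β).smul_const (innerSL ℝ e))).sub (h2.const_smul γ)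
  have h3 := h.fderiv
  unfold hess2
  rw [iteratedFDeriv_two_apply, fderiv_quadPoly]
  erw [h3]
  have h4 : innerSL ℝ (EuclideanSpace.single i (1 : ℝ)) (EuclideanSpace.single j (1 : ℝ)) =
      if i = j then 1 else 0 := by
    rw [innerSL_apply_apply, EuclideanSpace.inner_single_left]
    simp
  simp [Matrix.vecMulVec_apply, Matrix.one_apply, EuclideanSpace.inner_single_right, h4, mul_assoc]

theorem le_opNorm_smul_vecMulVec {n : ℕ} (e : Euc n) {β : ℝ} (hβ : 0 ≤ β) :
    β * ‖e‖ ^ 2 ≤ opNorm (β • Matrix.vecMulVec (fun i => e i) (fun i => e i)) := by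
  rcases eq_or_ne e 0 with rfl | he
  · simp [opNorm]
  have hpos : 0 < ‖e‖ := norm_pos_iff.2 he
  have key : Matrix.toEuclideanCLM (𝕜 := ℝ)
      (β • Matrix.vecMulVec (fun i => e i) (fun i => e i)) e = (β * ‖e‖ ^ 2) • e := by
    have hn : ‖e‖ ^ 2 = ∑ x, e x * e x := by
      rw [EuclideanSpace.norm_sq_eq]
      simp [pow_two]
    rw [hn]
    ext i
    simp [Matrix.vecMulVec_mulVec, dotProduct]
    ring
  have := (Matrix.toEuclideanCLM (𝕜 := ℝ)
      (β • Matrix.vecMulVec (fun i => e i) (fun i => e i))).le_opNorm e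
  rw [key, norm_smul, Real.norm_of_nonneg (by positivity)] at this
  exact le_of_mul_le_mul_right this hpos

theorem opNorm_smul_one_le {n : ℕ} {γ : ℝ} (hγ : 0 ≤ γ) :
    opNorm (γ • (1 : Matrix (Fin n) (Fin n) ℝ)) ≤ γ := by
  unfold opNorm
  rw [map_smul, map_one, norm_smul, Real.norm_of_nonneg hγ]
  exact mul_le_of_le_one_right hγ ContinuousLinearMap.norm_id_le

theorem posSemidef_smul_vecMulVec {n : ℕ} (e : Euc n) {β : ℝ} (hβ : 0 ≤ β) :
    (β • Matrix.vecMulVec (fun i => e i) (fun i => e i)).PosSemidef := by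
  have := Matrix.posSemidef_vecMulVec_self_star (R := ℝ) (fun i => e i)
  simpa only [star_trivial] using this.smul hβ

theorem posSemidef_smul_one {n : ℕ} {γ : ℝ} (hγ : 0 ≤ γ) :
    (γ • (1 : Matrix (Fin n) (Fin n) ℝ)).PosSemidef :=
  Matrix.PosSemidef.one.smul hγ

theorem isSymm_smul_vecMulVec_sub {n : ℕ} (e : Euc n) (β γ : ℝ) :
    (β • Matrix.vecMulVec (fun i => e i) (fun i => e i) -
      γ • (1 : Matrix (Fin n) (Fin n) ℝ)).IsSymm := by
  ext i j
  simp [Matrix.vecMulVec_apply, Matrix.one_apply, eq_comm, mul_comm]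

theorem nonneg_of_lt_mul_norm_sq {n : ℕ} {κ β γ : ℝ} {e : Euc n} (hκ : 0 < κ) (hγ : 0 ≤ γ)
    (h : κ * γ < β * ‖e‖ ^ 2) : 0 ≤ β := by
  by_contra hneg
  have h1 : β * ‖e‖ ^ 2 ≤ 0 := mul_nonpos_of_nonpos_of_nonneg (not_le.1 hneg).le (by positivity)
  have h2 : 0 ≤ κ * γ := by positivity
  linarith

theorem ViscSupersol.quadSupersol {n : ℕ} {lb ub : ℝ} (hlb : 0 < lb) (hle : lb ≤ ub)
    {F : Matrix (Fin n) (Fin n) ℝ → ℝ} (hF : UniformlyElliptic F lb ub) (hF0 : F 0 = 0)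
    {U : Set (Euc n)} {u : Euc n → ℝ} (hu : ViscSupersol F U u) :
    QuadSupersol (ub / lb) U u := by
  intro x₀ hx₀ p e β γ hγ hβγ hev
  have hκ : 0 < ub / lb := div_pos (hlb.trans_le hle) hlb
  have hβ := nonneg_of_lt_mul_norm_sq hκ hγ hβγ
  have h1 := hu x₀ hx₀ (quadPoly x₀ (u x₀) p e β γ) (contDiff_quadPoly ..) (quadPoly_self ..) hev
  rw [hess2_quadPoly] at h1
  have hs : (-(γ • (1 : Matrix (Fin n) (Fin n) ℝ))).IsSymm := by
    simp [Matrix.IsSymm]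
  have h2 := (hF _ _ hs (posSemidef_smul_vecMulVec e hβ)).1
  have h3 := (hF _ _ hs (posSemidef_smul_one hγ)).2
  rw [neg_add_cancel, hF0] at h3
  rw [neg_add_eq_sub] at h2
  have h4 := mul_le_mul_of_nonneg_left (le_opNorm_smul_vecMulVec e hβ) hlb.le
  have h5 := mul_le_mul_of_nonneg_left (opNorm_smul_one_le (n := n) hγ) (hlb.trans_le hle).le
  rw [div_mul_eq_mul_div, div_lt_iff₀ hlb] at hβγ
  nlinarith

theorem ViscSubsol.quadSupersol_neg {n : ℕ} {lb ub : ℝ} (hlb : 0 < lb) (hle : lb ≤ ub)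
    {F : Matrix (Fin n) (Fin n) ℝ → ℝ} (hF : UniformlyElliptic F lb ub) (hF0 : F 0 = 0)
    {U : Set (Euc n)} {u : Euc n → ℝ} (hu : ViscSubsol F U u) :
    QuadSupersol (ub / lb) U (fun x => -u x) := by
  intro x₀ hx₀ p e β γ hγ hβγ hev
  have hκ : 0 < ub / lb := div_pos (hlb.trans_le hle) hlb
  have hβ := nonneg_of_lt_mul_norm_sq hκ hγ hβγ
  have h1 := hu x₀ hx₀ (quadPoly x₀ (u x₀) (-p) e (-β) (-γ)) (contDiff_quadPoly ..)
    (quadPoly_self ..) (hev.mono fun x hx => by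
      simp only [quadPoly, inner_neg_left] at hx ⊢
      linarith)
  rw [hess2_quadPoly] at h1
  have hs := isSymm_smul_vecMulVec_sub e (-β) (-γ)
  have h2 := (hF _ _ hs (posSemidef_smul_vecMulVec e hβ)).1
  have h3 := (hF _ _ Matrix.isSymm_zero (posSemidef_smul_one (n := n) hγ)).2
  have h6 : (-β) • Matrix.vecMulVec (fun i => e i) (fun i => e i) -
      (-γ) • (1 : Matrix (Fin n) (Fin n) ℝ) + β • Matrix.vecMulVec (fun i => e i) (fun i => e i)
      = 0 + γ • (1 : Matrix (Fin n) (Fin n) ℝ) := by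
    simp only [neg_smul, zero_add]; abel
  rw [h6] at h2
  rw [hF0] at h3
  have h4 := mul_le_mul_of_nonneg_left (le_opNorm_smul_vecMulVec e hβ) hlb.le
  have h5 := mul_le_mul_of_nonneg_left (opNorm_smul_one_le (n := n) hγ) (hlb.trans_le hle).le
  rw [div_mul_eq_mul_div, div_lt_iff₀ hlb] at hβγ
  nlinarith

/-- If paraboloids of opening `-a` with vertices `y₁`, `y₂` touch a supersolution from below at
nearby points, then the distance of the vertices is controlled by that of the contact points. -/
theorem QuadSupersol.norm_vertex_sub_le {n : ℕ} {κ : ℝ} (hκ : 0 < κ) {c : Euc n} {R : ℝ}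
    {w : Euc n → ℝ} (hw : QuadSupersol κ (closedBall c R) w)
    (hlsc : LowerSemicontinuousOn w (closedBall c R)) {a r : ℝ} (ha : 0 < a) (hr : 0 < r)
    {x₁ x₂ y₁ y₂ : Euc n} (hx₁ : closedBall x₁ (3 * (2 * κ + 1) * r) ⊆ closedBall c R)
    (hx₂ : x₂ ∈ closedBall c R) (h₁₂ : ‖x₂ - x₁‖ ≤ r)
    (ht₁ : ∀ x ∈ closedBall c R, w x₁ + a / 2 * ‖x₁ - y₁‖ ^ 2 ≤ w x + a / 2 * ‖x - y₁‖ ^ 2)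
    (ht₂ : ∀ x ∈ closedBall c R, w x₂ + a / 2 * ‖x₂ - y₂‖ ^ 2 ≤ w x + a / 2 * ‖x - y₂‖ ^ 2) :
    ‖y₂ - y₁‖ ≤ 5 * (2 * κ + 1) * r := by
  by_contra! hcon
  set N : ℝ := 2 * κ + 1 with hN
  have hN1 : 1 < N := by linarith
  set q := y₂ - y₁ with hq
  have hqpos : 0 < ‖q‖ := lt_trans (by positivity) hcon
  set e : Euc n := ‖q‖⁻¹ • q with he
  have hqe : q = ‖q‖ • e := by rw [he, smul_smul, mul_inv_cancel₀ hqpos.ne', one_smul]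
  have he1 : ‖e‖ = 1 := by
    rw [he, norm_smul, norm_inv, norm_norm, inv_mul_cancel₀ hqpos.ne']
  set K : Set (Euc n) := closedBall x₁ (3 * N * r) ∩
    {x | -r ≤ ⟪e, x - x₁⟫ ∧ ⟪e, x - x₁⟫ ≤ 2 * r} with hK
  have hcont : Continuous fun x : Euc n => ⟪e, x - x₁⟫ := by fun_prop
  have hKc : IsCompact K := by
    refine (isCompact_closedBall _ _).inter_right ?_
    exact (isClosed_le continuous_const hcont).inter (isClosed_le hcont continuous_const)
  have hx₁K : x₁ ∈ K := by
    refine ⟨mem_closedBall_self (by positivity), ?_⟩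
    simp only [mem_ofPred_eq, sub_self, inner_zero_right]
    constructor <;> linarith
  have hKU : K ⊆ closedBall c R := inter_subset_left.trans hx₁
  have hflsc : LowerSemicontinuousOn (fun x => w x + (a / 2 * ‖x - y₁‖ ^ 2 -
      a / 2 * (N * (⟪e, x - x₁⟫ + r) ^ 2 - ‖x - x₁‖ ^ 2))) K := by
    refine (hlsc.mono hKU).add (ContinuousOn.lowerSemicontinuousOn (Continuous.continuousOn ?_))
    fun_prop
  obtain ⟨z, hzK, hzmin⟩ := LowerSemicontinuousOn.exists_isMinOn ⟨x₁, hx₁K⟩ hKc hflsc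
  have hmin : ∀ x ∈ K, w z + (a / 2 * ‖z - y₁‖ ^ 2 -
      a / 2 * (N * (⟪e, z - x₁⟫ + r) ^ 2 - ‖z - x₁‖ ^ 2)) ≤ w x + (a / 2 * ‖x - y₁‖ ^ 2 -
      a / 2 * (N * (⟪e, x - x₁⟫ + r) ^ 2 - ‖x - x₁‖ ^ 2)) := fun x hx => hzmin hx
  clear_value e
  obtain ⟨hzball, hzT₁, hzT₂⟩ := hzK
  rw [mem_closedBall, dist_eq_norm] at hzball
  have hz0 := hmin x₁ hx₁K
  simp only [sub_self, inner_zero_right, norm_zero] at hz0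
  have hG0 := ht₁ z (hKU ⟨by rwa [mem_closedBall, dist_eq_norm], hzT₁, hzT₂⟩)
  have hG1 : w x₁ + a / 2 * ‖x₁ - y₁‖ ^ 2 + a * ‖q‖ * (⟪e, z - x₁⟫ - r) ≤
      w z + a / 2 * ‖z - y₁‖ ^ 2 := by
    have h1 := ht₁ x₂ hx₂
    have h2 := ht₂ z (hKU ⟨by rwa [mem_closedBall, dist_eq_norm], hzT₁, hzT₂⟩)
    have h3 : ∀ x : Euc n, ‖x - y₂‖ ^ 2 = ‖x - y₁‖ ^ 2 - 2 * (‖q‖ * (⟪e, x - x₁⟫ +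
        ⟪e, x₁ - y₁⟫)) + ‖q‖ ^ 2 := by
      intro x
      have : x - y₂ = (x - y₁) - q := by rw [hq]; abel
      have hxq : ⟪x - y₁, q⟫ = ‖q‖ * (⟪e, x - x₁⟫ + ⟪e, x₁ - y₁⟫) := by
        rw [← inner_add_right, sub_add_sub_cancel, ← real_inner_smul_left, ← hqe, real_inner_comm]
      rw [this, norm_sub_sq_real, hxq]
    rw [h3, h3] at h2
    have h4 : ⟪e, x₂ - x₁⟫ ≤ r := by
      have := real_inner_le_norm e (x₂ - x₁)
      rw [he1, one_mul] at this
      exact this.trans h₁₂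
    have h5 : a * ‖q‖ * ⟪e, x₂ - x₁⟫ ≤ a * ‖q‖ * r := by gcongr
    linarith
  set T := ⟪e, z - x₁⟫ with hT
  have hS0 : 0 ≤ ‖z - x₁‖ := norm_nonneg _
  have hmain : N * r ^ 2 ≤ N * (T + r) ^ 2 - ‖z - x₁‖ ^ 2 := by
    have : a * (N * r ^ 2) ≤ a * (N * (T + r) ^ 2 - ‖z - x₁‖ ^ 2) := by linarith
    exact le_of_mul_le_mul_left this ha
  have hNr : 0 < N * r ^ 2 := by positivity
  have hT1 : -r < T := by
    refine lt_of_le_of_ne hzT₁ fun h => ?_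
    rw [← h] at hmain
    nlinarith
  have hT2 : T < 2 * r := by
    refine lt_of_le_of_ne hzT₂ fun h => ?_
    rw [h] at hG1 hz0
    have h1 : a * (N * r ^ 2 + 2 * (‖q‖ * r)) ≤ a * (N * (2 * r + r) ^ 2 - ‖z - x₁‖ ^ 2) := by
      linarith
    have h2 := le_of_mul_le_mul_left h1 ha
    have h3 : 5 * N * r * r ≤ ‖q‖ * r := by gcongr
    nlinarith
  have hS : ‖z - x₁‖ < 3 * N * r := by
    by_contra! h
    have h1 : (3 * N * r) ^ 2 ≤ ‖z - x₁‖ ^ 2 := by gcongr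
    have h2 : (T + r) ^ 2 ≤ (3 * r) ^ 2 := by
      have : 0 ≤ T + r := by linarith
      gcongr
      linarith
    have h3 : N * (T + r) ^ 2 ≤ N * (3 * r) ^ 2 := by gcongr
    nlinarith
  refine hw z (hKU ⟨by rwa [mem_closedBall, dist_eq_norm], hzT₁, hzT₂⟩)
    ((a * N * (T + r)) • e - a • (z - x₁) - a • (z - y₁)) e (a * N) (2 * a) (by positivity) ?_ ?_
  · rw [he1]
    nlinarith
  have hev1 : ∀ᶠ x in nhds z, ‖x - x₁‖ < 3 * N * r :=
    (by fun_prop : Continuous fun x : Euc n => ‖x - x₁‖).continuousAt.eventually_lt_const hS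
  have hev2 : ∀ᶠ x in nhds z, -r < ⟪e, x - x₁⟫ := hcont.continuousAt.eventually_const_lt hT1
  have hev3 : ∀ᶠ x in nhds z, ⟪e, x - x₁⟫ < 2 * r := hcont.continuousAt.eventually_lt_const hT2
  filter_upwards [hev1, hev2, hev3] with x h1 h2 h3
  have h4 := hmin x ⟨by rw [mem_closedBall, dist_eq_norm]; exact h1.le, h2.le, h3.le⟩
  have e1 : ⟪e, x - x₁⟫ = T + ⟪e, x - z⟫ := by
    rw [hT, ← inner_add_right]; congr 1; abel
  have e2 : ∀ y : Euc n, ‖x - y‖ ^ 2 = ‖z - y‖ ^ 2 + 2 * ⟪z - y, x - z⟫ + ‖x - z‖ ^ 2 := by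
    intro y
    rw [← norm_add_sq_real]; congr 2; abel
  rw [e1, e2 x₁, e2 y₁] at h4
  simp only [inner_sub_left (𝕜 := ℝ) _ _ (x - z), real_inner_smul_left] at h4 ⊢
  linarith

/-- A nonnegative supersolution that is at least `b` on a ball lies above a Gaussian barrier. -/
theorem QuadSupersol.barrier_le {n : ℕ} {κ : ℝ} (hκ : 0 < κ) {c : Euc n} {R : ℝ}
    {w : Euc n → ℝ} (hw : QuadSupersol κ (closedBall c R) w)
    (hlsc : LowerSemicontinuousOn w (closedBall c R)) (hnn : ∀ x ∈ closedBall c R, 0 ≤ w x)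
    {ρ b : ℝ} (hρ : 0 < ρ) (hb : 0 < b)
    (hbw : ∀ x ∈ closedBall c R, ‖x - c‖ ≤ ρ → b ≤ w x) {x : Euc n} (hx : x ∈ closedBall c R) :
    b * (Real.exp (-(4 * κ / ρ ^ 2 * ‖x - c‖ ^ 2)) - Real.exp (-(4 * κ / ρ ^ 2 * R ^ 2))) ≤
      w x := by
  by_contra! hcon
  set A : ℝ := 4 * κ / ρ ^ 2 with hA
  have hA0 : 0 < A := by positivity
  have hAρ : A * ρ ^ 2 = 4 * κ := by rw [hA]; field_simp
  have hflsc : LowerSemicontinuousOn (fun x => w x + -(b * (Real.exp (-(A * ‖x - c‖ ^ 2)) -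
      Real.exp (-(A * R ^ 2))))) (closedBall c R) := by
    refine hlsc.add (ContinuousOn.lowerSemicontinuousOn (Continuous.continuousOn ?_))
    fun_prop
  obtain ⟨z, hz, hzmin⟩ := LowerSemicontinuousOn.exists_isMinOn ⟨x, hx⟩
    (isCompact_closedBall c R) hflsc
  have hmin : ∀ y ∈ closedBall c R, w z + -(b * (Real.exp (-(A * ‖z - c‖ ^ 2)) -
      Real.exp (-(A * R ^ 2)))) ≤ w y + -(b * (Real.exp (-(A * ‖y - c‖ ^ 2)) -
      Real.exp (-(A * R ^ 2)))) := fun y hy => hzmin hy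
  have hzx := hmin x hx
  have hzR : ‖z - c‖ ≤ R := by rwa [mem_closedBall, dist_eq_norm] at hz
  have hz1 : ρ < ‖z - c‖ := by
    by_contra! h
    have h1 := hbw z hz h
    have h2 : Real.exp (-(A * ‖z - c‖ ^ 2)) ≤ 1 := Real.exp_le_one_iff.2 (by
      have : 0 ≤ A * ‖z - c‖ ^ 2 := by positivity
      linarith)
    have h3 := Real.exp_pos (-(A * R ^ 2))
    have h4 : b * (Real.exp (-(A * ‖z - c‖ ^ 2)) - Real.exp (-(A * R ^ 2))) ≤ b * 1 :=
      mul_le_mul_of_nonneg_left (by linarith) hb.le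
    linarith
  have hz2 : ‖z - c‖ < R := by
    refine lt_of_le_of_ne hzR fun h => ?_
    have h1 := hnn z hz
    rw [h, sub_self, mul_zero] at hzx
    linarith
  set E := Real.exp (-(A * ‖z - c‖ ^ 2)) with hE
  have hE0 : 0 < E := Real.exp_pos _
  refine hw z hz (-(2 * A * b * E) • (z - c)) (z - c) (2 * A ^ 2 * b * E) (4 * A * b * E)
    (by positivity) ?_ ?_
  · have h1 : ρ ^ 2 < ‖z - c‖ ^ 2 := by gcongr
    have h2 : 4 * κ < A * ‖z - c‖ ^ 2 := by rw [← hAρ]; gcongr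
    have h3 : κ * (4 * A * b * E) = (2 * A * b * E) * (2 * κ) := by ring
    have h4 : 2 * A ^ 2 * b * E * ‖z - c‖ ^ 2 = (2 * A * b * E) * (A * ‖z - c‖ ^ 2) := by ring
    rw [h3, h4]
    exact mul_lt_mul_of_pos_left (by linarith) (by positivity)
  have hev1 : ∀ᶠ y in nhds z, ‖y - c‖ < R :=
    (by fun_prop : Continuous fun y : Euc n => ‖y - c‖).continuousAt.eventually_lt_const hz2
  have hev2 : ∀ᶠ y in nhds z, A * ‖z - c‖ * ‖y - z‖ < 1 / 2 :=
    (by fun_prop : Continuous fun y : Euc n =>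
      A * ‖z - c‖ * ‖y - z‖).continuousAt.eventually_lt_const (by simp)
  have hev3 : ∀ᶠ y in nhds z, A * ‖y - z‖ ^ 2 < 1 :=
    (by fun_prop : Continuous fun y : Euc n => A * ‖y - z‖ ^ 2).continuousAt.eventually_lt_const
      (by simp)
  filter_upwards [hev1, hev2, hev3] with y h1 h2 h3
  have h4 := hmin y (by rw [mem_closedBall, dist_eq_norm]; exact h1.le)
  set I := ⟪z - c, y - z⟫ with hI
  set d := ‖y - z‖ with hd
  have hd0 : 0 ≤ d := norm_nonneg _
  have hI1 : |I| ≤ ‖z - c‖ * d := abs_real_inner_le_norm _ _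
  have e1 : ‖y - c‖ ^ 2 = ‖z - c‖ ^ 2 + (2 * I + d ^ 2) := by
    rw [← add_assoc, ← norm_add_sq_real]; congr 2; abel
  have e2 : Real.exp (-(A * ‖y - c‖ ^ 2)) = E * Real.exp (-(A * (2 * I + d ^ 2))) := by
    rw [hE, ← Real.exp_add, e1]; ring_nf
  have hAI : A * |I| ≤ 1 / 2 := by
    have : A * |I| ≤ A * (‖z - c‖ * d) := by gcongr
    linarith
  have hAI' : A * I ≤ 1 / 2 := le_trans (by gcongr; exact le_abs_self I) hAI
  have hAI'' : -(1 / 2) ≤ A * I := by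
    have : A * (-I) ≤ A * |I| := by gcongr; exact neg_le_abs I
    linarith
  have e3 : 1 - 2 * A * I - 2 * A * d ^ 2 + A ^ 2 * I ^ 2 ≤
      Real.exp (-(A * (2 * I + d ^ 2))) := by
    have h5 : 0 ≤ 1 - A * (2 * I + d ^ 2) / 2 := by linarith
    have h6 := Real.add_one_le_exp (-(A * (2 * I + d ^ 2) / 2))
    have h7 : Real.exp (-(A * (2 * I + d ^ 2))) = Real.exp (-(A * (2 * I + d ^ 2) / 2)) ^ 2 := by
      rw [← Real.exp_nat_mul]; congr 1; push_cast; ring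
    have h8 : (1 - A * (2 * I + d ^ 2) / 2) ^ 2 ≤ Real.exp (-(A * (2 * I + d ^ 2) / 2)) ^ 2 := by
      gcongr; linarith
    rw [h7]
    refine le_trans ?_ h8
    have h9 : -(1 / 2) * (A * d ^ 2) ≤ A * I * (A * d ^ 2) := by gcongr
    have h10 : 0 ≤ (A * d ^ 2) ^ 2 := by positivity
    nlinarith [mul_nonneg hA0.le (sq_nonneg d)]
  have e4 : b * E * (1 - 2 * A * I - 2 * A * d ^ 2 + A ^ 2 * I ^ 2) ≤
      b * E * Real.exp (-(A * (2 * I + d ^ 2))) := by gcongr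
  rw [e2] at h4
  rw [real_inner_smul_left, ← hI]
  linarith

/-- Lower bounds of supersolutions propagate to concentric larger balls, in contrapositive form. -/
theorem exists_le_of_le_of_quadSupersol {κ : ℝ} (hκ : 0 < κ) {m : ℝ} (hm : 1 ≤ m) :
    ∃ C : ℝ, 1 ≤ C ∧ ∀ {n : ℕ} {c : Euc n} {ρ s : ℝ} {w : Euc n → ℝ}, 0 < ρ → 0 < s →
      QuadSupersol κ (closedBall c (2 * m * ρ)) w →
      LowerSemicontinuousOn w (closedBall c (2 * m * ρ)) →
      (∀ x ∈ closedBall c (2 * m * ρ), 0 ≤ w x) →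
      (∃ x ∈ closedBall c (m * ρ), w x ≤ s) → ∃ x ∈ closedBall c ρ, w x ≤ C * s := by
  set t := Real.exp (-(4 * κ * m ^ 2)) - Real.exp (-(16 * κ * m ^ 2)) with ht
  have hκm : 0 < κ * m ^ 2 := by positivity
  have ht0 : 0 < t := sub_pos.2 (Real.exp_lt_exp.2 (by linarith))
  have ht1 : t ≤ 1 := by
    have h1 : Real.exp (-(4 * κ * m ^ 2)) ≤ 1 := Real.exp_le_one_iff.2 (by linarith)
    have h2 := Real.exp_pos (-(16 * κ * m ^ 2))
    linarith
  refine ⟨2 / t, by rw [le_div_iff₀ ht0]; linarith, ?_⟩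
  rintro n c ρ s w hρ hs hw hlsc hnn ⟨x, hx, hxs⟩
  by_contra! hcon
  have hsub : closedBall c (m * ρ) ⊆ closedBall c (2 * m * ρ) :=
    closedBall_subset_closedBall (by nlinarith)
  have h := hw.barrier_le hκ hlsc hnn (b := 2 / t * s) hρ (by positivity)
    (fun y _ hy => (hcon y (by rwa [mem_closedBall, dist_eq_norm])).le) (hsub hx)
  have h1 : t ≤ Real.exp (-(4 * κ / ρ ^ 2 * ‖x - c‖ ^ 2)) -
      Real.exp (-(4 * κ / ρ ^ 2 * (2 * m * ρ) ^ 2)) := by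
    have e1 : 4 * κ / ρ ^ 2 * (2 * m * ρ) ^ 2 = 16 * κ * m ^ 2 := by field_simp; ring
    have e2 : 4 * κ / ρ ^ 2 * ‖x - c‖ ^ 2 ≤ 4 * κ * m ^ 2 := by
      rw [mem_closedBall, dist_eq_norm] at hx
      calc 4 * κ / ρ ^ 2 * ‖x - c‖ ^ 2 ≤ 4 * κ / ρ ^ 2 * (m * ρ) ^ 2 := by gcongr
        _ = 4 * κ * m ^ 2 := by field_simp
    rw [e1, ht]
    gcongr
  have h2 : 2 / t * s * t ≤ w x := le_trans (by gcongr) h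
  have h3 : 2 / t * s * t = 2 * s := by field_simp
  linarith

theorem hausdorffMeasure_le_of_dist_le {X : Type*} [MetricSpace X] [MeasurableSpace X]
    [BorelSpace X] {K : NNReal} {f : X → X} {V : Set X}
    (hf : ∀ x ∈ V, ∀ y ∈ V, dist x y ≤ K * dist (f x) (f y)) {d : ℝ} (hd : 0 ≤ d) :
    Measure.hausdorffMeasure d V ≤ (K : ENNReal) ^ d * Measure.hausdorffMeasure d (f '' V) := by
  rcases V.eq_empty_or_nonempty with rfl | ⟨v, hv⟩
  · simp
  have : Nonempty X := ⟨v⟩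
  have hinj : InjOn f V := fun x hx y hy hxy => by
    have := hf x hx y hy
    rw [hxy, dist_self, mul_zero] at this
    exact dist_le_zero.1 this
  have hinv := hinj.leftInvOn_invFunOn
  have hlip : LipschitzOnWith K (Function.invFunOn f V) (f '' V) := by
    refine LipschitzOnWith.of_dist_le_mul ?_
    rintro _ ⟨x, hx, rfl⟩ _ ⟨y, hy, rfl⟩
    rw [hinv hx, hinv hy]
    exact hf x hx y hy
  have h := hlip.hausdorffMeasure_image_le hd
  rwa [hinv.image_image] at h

theorem hausdorffMeasure_closedBall_mul {n : ℕ} (x y : Euc n) {t r : ℝ} (ht : 0 ≤ t)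
    (hr : 0 ≤ r) : Measure.hausdorffMeasure (n : ℝ) (closedBall x (t * r)) =
      ENNReal.ofReal (t ^ n) * Measure.hausdorffMeasure (n : ℝ) (closedBall y r) := by
  rw [Measure.addHaar_closedBall_mul _ x ht hr, Measure.addHaar_closedBall_center,
    Measure.addHaar_closedBall_center _ y, finrank_euclideanSpace_fin]

/-- A nonnegative supersolution that is small somewhere near a ball is small on a fixed fraction
of that ball. -/
theorem exists_hausdorffMeasure_closedBall_le {κ : ℝ} (hκ : 0 < κ) (n : ℕ) :
    ∃ M : ℝ, 1 ≤ M ∧ ∃ Θ : NNReal, 1 ≤ Θ ∧ ∀ {c : Euc n} {r s : ℝ} {w : Euc n → ℝ}, 0 < r →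
      0 < s → QuadSupersol κ (closedBall c ((12 * κ + 22) * r)) w →
      LowerSemicontinuousOn w (closedBall c ((12 * κ + 22) * r)) →
      (∀ x ∈ closedBall c ((12 * κ + 22) * r), 0 ≤ w x) →
      (∃ x ∈ closedBall c (8 * r), w x ≤ s) →
      Measure.hausdorffMeasure (n : ℝ) (closedBall c r) ≤
        Θ * Measure.hausdorffMeasure (n : ℝ) (closedBall c r ∩ {x | w x ≤ M * s}) := by
  obtain ⟨C, hC, hex⟩ := exists_le_of_le_of_quadSupersol hκ (m := 32) (by norm_num)
  refine ⟨3 * C, by linarith, (16 * (5 * (2 * κ + 1))).toNNReal ^ n, one_le_pow₀ ?_, ?_⟩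
  · rw [Real.one_le_toNNReal]; linarith
  rintro c r s w hr hs hw hlsc hnn ⟨x₁, hx₁, hx₁s⟩
  have h16 : closedBall c (2 * 32 * (r / 4)) ⊆ closedBall c ((12 * κ + 22) * r) :=
    closedBall_subset_closedBall (by nlinarith)
  obtain ⟨x₂, hx₂, hx₂s⟩ := hex (by positivity) hs (hw.mono h16) (hlsc.mono h16)
    (fun x hx => hnn x (h16 hx)) ⟨x₁, by convert hx₁ using 2; ring, hx₁s⟩
  set R := (12 * κ + 22) * r with hR
  have hrR : r ≤ R := by rw [hR]; nlinarith
  have hx₂R : x₂ ∈ closedBall c R := closedBall_subset_closedBall (by linarith) hx₂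
  set a := 32 * C * s / r ^ 2 with ha
  have ha0 : 0 < a := by positivity
  have har : a * r ^ 2 = 32 * C * s := by rw [ha]; field_simp
  have hmin : ∀ y : Euc n, ∃ z ∈ closedBall c R, ∀ x ∈ closedBall c R,
      w z + a / 2 * ‖z - y‖ ^ 2 ≤ w x + a / 2 * ‖x - y‖ ^ 2 := by
    intro y
    have hlsc' : LowerSemicontinuousOn (fun x => w x + a / 2 * ‖x - y‖ ^ 2) (closedBall c R) := by
      refine hlsc.add (ContinuousOn.lowerSemicontinuousOn (Continuous.continuousOn ?_))
      fun_prop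
    obtain ⟨z, hz, hzmin⟩ := LowerSemicontinuousOn.exists_isMinOn ⟨x₂, hx₂R⟩
      (isCompact_closedBall c R) hlsc'
    exact ⟨z, hz, fun x hx => hzmin hx⟩
  choose X hXR hX using hmin
  have hXval : ∀ y ∈ closedBall c (r / 16),
      w (X y) + a / 2 * ‖X y - y‖ ^ 2 ≤ C * s + a / 2 * (5 / 16 * r) ^ 2 := by
    intro y hy
    refine (hX y x₂ hx₂R).trans ?_
    have h1 : ‖x₂ - y‖ ≤ 5 / 16 * r := by
      rw [← dist_eq_norm]
      have := dist_triangle_right x₂ y c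
      rw [mem_closedBall] at hx₂ hy
      linarith
    gcongr
  have hXin : ∀ y ∈ closedBall c (r / 16), X y ∈ closedBall c (r / 2) := by
    intro y hy
    by_contra hcon
    rw [mem_closedBall, not_le] at hcon
    rw [mem_closedBall] at hy
    have h1 : 7 / 16 * r ≤ ‖X y - y‖ := by
      rw [← dist_eq_norm]
      have := dist_triangle (X y) y c
      linarith
    have h2 : a / 2 * (7 / 16 * r) ^ 2 ≤ a / 2 * ‖X y - y‖ ^ 2 := by gcongr
    have h3 := hXval y hy
    have h4 := hnn _ (hXR y)
    have h5 : 0 < C * s := by positivity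
    nlinarith
  have hXle : ∀ y ∈ closedBall c (r / 16), w (X y) ≤ 3 * C * s := by
    intro y hy
    have h1 := hXval y hy
    have h2 : 0 ≤ a / 2 * ‖X y - y‖ ^ 2 := by positivity
    have h5 : 0 < C * s := by positivity
    nlinarith
  have hlip : ∀ y₁ ∈ closedBall c (r / 16), ∀ y₂ ∈ closedBall c (r / 16),
      dist y₁ y₂ ≤ (5 * (2 * κ + 1)).toNNReal * dist (X y₁) (X y₂) := by
    intro y₁ hy₁ y₂ hy₂
    have hX₁ := hXin y₁ hy₁
    have hX₂ := hXin y₂ hy₂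
    have hXX : dist (X y₁) (X y₂) ≤ r := by
      have := dist_triangle_right (X y₁) (X y₂) c
      rw [mem_closedBall] at hX₁ hX₂
      linarith
    rw [Real.coe_toNNReal _ (by positivity)]
    refine le_of_forall_pos_le_add fun ε hε => ?_
    set δ := min (ε / (5 * (2 * κ + 1))) r with hδ
    have hδ0 : 0 < δ := lt_min (by positivity) hr
    have hδε : 5 * (2 * κ + 1) * δ ≤ ε := by
      rw [← le_div_iff₀' (by positivity)]
      exact min_le_left _ _
    have hδr : δ ≤ r := min_le_right _ _
    have h := hw.norm_vertex_sub_le hκ hlsc ha0 (r := dist (X y₁) (X y₂) + δ) (by positivity)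
      (x₁ := X y₁) (x₂ := X y₂) ?_ (hXR y₂) ?_ (hX y₁) (hX y₂)
    · rw [← dist_eq_norm, dist_comm] at h
      linarith
    · refine closedBall_subset_closedBall' ?_
      rw [mem_closedBall] at hX₁
      have : 3 * (2 * κ + 1) * (dist (X y₁) (X y₂) + δ) ≤ 3 * (2 * κ + 1) * (r + r) := by gcongr
      rw [hR]
      nlinarith
    · rw [← dist_eq_norm, dist_comm]
      linarith
  have h1 := hausdorffMeasure_le_of_dist_le hlip (Nat.cast_nonneg n)
  have h2 : closedBall c r = closedBall c (16 * (r / 16)) := by congr 1; ring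
  have h3 : X '' closedBall c (r / 16) ⊆ closedBall c r ∩ {x | w x ≤ 3 * C * s} := by
    rintro _ ⟨y, hy, rfl⟩
    exact ⟨closedBall_subset_closedBall (by linarith) (hXin y hy), hXle y hy⟩
  calc Measure.hausdorffMeasure (n : ℝ) (closedBall c r)
      = ENNReal.ofReal (16 ^ n) * Measure.hausdorffMeasure (n : ℝ) (closedBall c (r / 16)) := by
        rw [h2, hausdorffMeasure_closedBall_mul c c (by norm_num) (by positivity)]
    _ ≤ ENNReal.ofReal (16 ^ n) * (((5 * (2 * κ + 1)).toNNReal : ENNReal) ^ (n : ℝ) *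
          Measure.hausdorffMeasure (n : ℝ) (closedBall c r ∩ {x | w x ≤ 3 * C * s})) := by
        gcongr
        exact h1.trans (by gcongr)
    _ = _ := by
        rw [← mul_assoc, ENNReal.rpow_natCast, ENNReal.ofReal_pow (by norm_num), ← mul_pow,
          Real.toNNReal_mul (p := 16) (by norm_num)]
        push_cast
        rfl

theorem closedBall_contraction_subset {n : ℕ} {c x : Euc n} {ρ d : ℝ} (hρ : 0 < ρ)
    (hx : x ∈ closedBall c ρ) (hd0 : 0 ≤ d) (hd : d ≤ ρ) :
    closedBall (c + (1 - d / ρ) • (x - c)) d ⊆ closedBall c ρ ∧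
      dist x (c + (1 - d / ρ) • (x - c)) ≤ d := by
  have hdρ : d / ρ ≤ 1 := (div_le_one hρ).2 hd
  have hdρ0 : 0 ≤ d / ρ := by positivity
  have hdd : d / ρ * ρ = d := by field_simp
  rw [mem_closedBall, dist_eq_norm] at hx
  constructor
  · refine closedBall_subset_closedBall' ?_
    rw [dist_eq_norm, add_sub_cancel_left, norm_smul, Real.norm_of_nonneg (by linarith)]
    nlinarith [mul_le_mul_of_nonneg_left hx (sub_nonneg.2 hdρ)]
  · have : x - (c + (1 - d / ρ) • (x - c)) = (d / ρ) • (x - c) := by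
      rw [sub_smul, one_smul]; abel
    rw [dist_eq_norm, this, norm_smul, Real.norm_of_nonneg hdρ0]
    calc d / ρ * ‖x - c‖ ≤ d / ρ * ρ := by gcongr
      _ = d := hdd

theorem exists_hausdorffMeasure_superlevel_le {κ : ℝ} (hκ : 0 < κ) (n : ℕ) :
    ∃ M : ℝ, 1 ≤ M ∧ ∃ Q : NNReal, 1 ≤ Q ∧ ∀ {c : Euc n} {ρ s : ℝ} {w : Euc n → ℝ}, 0 < ρ →
      0 < s → QuadSupersol κ (closedBall c ((12 * κ + 23) * ρ)) w →
      LowerSemicontinuousOn w (closedBall c ((12 * κ + 23) * ρ)) →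
      (∀ x ∈ closedBall c ((12 * κ + 23) * ρ), 0 ≤ w x) →
      (∃ x ∈ closedBall c ρ, w x ≤ s) →
      Measure.hausdorffMeasure (n : ℝ) (closedBall c ρ ∩ {x | s < w x}) ≤
        Q * Measure.hausdorffMeasure (n : ℝ)
          ((closedBall c ρ ∩ {x | s < w x}) \ (closedBall c ρ ∩ {x | M * s < w x})) := by
  obtain ⟨M, hM, Θ, hΘ, hML⟩ := exists_hausdorffMeasure_closedBall_le hκ n
  refine ⟨M, hM, 5 ^ n * Θ, one_le_mul (one_le_pow₀ (by norm_num)) hΘ, ?_⟩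
  rintro c ρ s w hρ hs hw hlsc hnn ⟨x₁, hx₁, hx₁s⟩
  have hρR : closedBall c ρ ⊆ closedBall c ((12 * κ + 23) * ρ) :=
    closedBall_subset_closedBall (by nlinarith)
  have hKc : ∀ t : ℝ, IsCompact (closedBall c ρ ∩ {x | w x ≤ t}) := fun t =>
    (hlsc.mono hρR).isCompact_inter_preimage_Iic (isCompact_closedBall c ρ) t
  set K := closedBall c ρ ∩ {x | w x ≤ s} with hK
  have hKne : K.Nonempty := ⟨x₁, hx₁, hx₁s⟩
  set A := closedBall c ρ ∩ {x | s < w x} with hA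
  set rad : Euc n → ℝ := fun x => infDist x K / 4 with hrad
  set cen : Euc n → Euc n := fun x => c + (1 - rad x / ρ) • (x - c) with hcen
  have hrad0 : ∀ x ∈ A, 0 < rad x := by
    intro x hx
    have : 0 < infDist x K := ((hKc s).isClosed.notMem_iff_infDist_pos hKne).1
      fun h => absurd (show w x ≤ s from h.2) (not_le.2 hx.2)
    simp only [hrad]
    linarith
  have hradle : ∀ x ∈ A, rad x ≤ ρ / 2 := by
    intro x hx
    have h1 := infDist_le_dist_of_mem (x := x) (show x₁ ∈ K from ⟨hx₁, hx₁s⟩)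
    have h2 := dist_triangle_right x x₁ c
    have h3 := mem_closedBall.1 hx.1
    have h4 := mem_closedBall.1 hx₁
    simp only [hrad]
    linarith
  have hgeo : ∀ x ∈ A, closedBall (cen x) (rad x) ⊆ closedBall c ρ ∧ dist x (cen x) ≤ rad x :=
    fun x hx => closedBall_contraction_subset hρ hx.1 (hrad0 x hx).le
      ((hradle x hx).trans (by linarith))
  have hsubA : ∀ x ∈ A, closedBall (cen x) (rad x) ⊆ A := by
    intro x hx y hy
    refine ⟨(hgeo x hx).1 hy, ?_⟩
    by_contra hcon
    have hys : w y ≤ s := not_lt.1 hcon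
    have h1 := infDist_le_dist_of_mem (x := x) (show y ∈ K from ⟨(hgeo x hx).1 hy, hys⟩)
    have h2 := dist_triangle_right x y (cen x)
    have h3 := (hgeo x hx).2
    have h4 := mem_closedBall.1 hy
    have h5 := hrad0 x hx
    simp only [hrad] at h3 h4 h5
    linarith
  have hball : ∀ x ∈ A, Measure.hausdorffMeasure (n : ℝ) (closedBall (cen x) (rad x)) ≤
      Θ * Measure.hausdorffMeasure (n : ℝ)
        (closedBall (cen x) (rad x) ∩ {x | w x ≤ M * s}) := by
    intro x hx
    have hcc : dist (cen x) c ≤ ρ :=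
      (hgeo x hx).1 (mem_closedBall_self (hrad0 x hx).le)
    have hsub : closedBall (cen x) ((12 * κ + 22) * rad x) ⊆
        closedBall c ((12 * κ + 23) * ρ) := by
      refine closedBall_subset_closedBall' ?_
      have : (12 * κ + 22) * rad x ≤ (12 * κ + 22) * (ρ / 2) := by
        gcongr
        exact hradle x hx
      nlinarith
    refine hML (hrad0 x hx) hs (hw.mono hsub) (hlsc.mono hsub) (fun y hy => hnn y (hsub hy)) ?_
    obtain ⟨z, hz, hzd⟩ := (hKc s).exists_infDist_eq_dist hKne x
    refine ⟨z, ?_, hz.2⟩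
    have h1 := dist_triangle_left z (cen x) x
    have h2 := (hgeo x hx).2
    have h3 := hrad0 x hx
    rw [mem_closedBall]
    simp only [hrad] at h2 h3 ⊢
    linarith
  obtain ⟨u, huA, hdisj, hcov⟩ :=
    Vitali.exists_disjoint_subfamily_covering_enlargement_closedBall A cen rad (ρ / 2) hradle 5
      (by norm_num)
  have hucount : u.Countable := hdisj.countable_of_nonempty_interior fun x hx =>
    ⟨cen x, ball_subset_interior_closedBall (mem_ball_self (hrad0 x (huA hx)))⟩
  have hAcov : A ⊆ ⋃ x ∈ u, closedBall (cen x) (5 * rad x) := by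
    intro x hx
    obtain ⟨y, hy, hxy⟩ := hcov x hx
    exact mem_biUnion hy (hxy (mem_closedBall.2 (hgeo x hx).2))
  have hmeas : ∀ x ∈ u, MeasurableSet (closedBall (cen x) (rad x) ∩ {x | w x ≤ M * s}) := by
    intro x hx
    have : closedBall (cen x) (rad x) ∩ {x | w x ≤ M * s} =
        closedBall (cen x) (rad x) ∩ (closedBall c ρ ∩ {x | w x ≤ M * s}) := by
      rw [← inter_assoc, inter_eq_self_of_subset_left (hgeo x (huA hx)).1]
    rw [this]
    exact (isClosed_closedBall.inter (hKc _).isClosed).measurableSet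
  calc Measure.hausdorffMeasure (n : ℝ) A
      ≤ Measure.hausdorffMeasure (n : ℝ) (⋃ x ∈ u, closedBall (cen x) (5 * rad x)) :=
        measure_mono hAcov
    _ ≤ ∑' x : u, Measure.hausdorffMeasure (n : ℝ) (closedBall (cen x) (5 * rad x)) :=
        measure_biUnion_le _ hucount _
    _ ≤ ∑' x : u, (5 ^ n * Θ : NNReal) * Measure.hausdorffMeasure (n : ℝ)
          (closedBall (cen x) (rad x) ∩ {x | w x ≤ M * s}) := by
        refine ENNReal.tsum_le_tsum fun x => ?_
        rw [hausdorffMeasure_closedBall_mul (cen x) (cen x) (by norm_num)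
          (hrad0 x (huA x.2)).le, ENNReal.ofReal_pow (by norm_num), ENNReal.ofReal_ofNat]
        push_cast
        rw [mul_assoc]
        gcongr
        exact hball x (huA x.2)
    _ = (5 ^ n * Θ : NNReal) * Measure.hausdorffMeasure (n : ℝ)
          (⋃ x ∈ u, closedBall (cen x) (rad x) ∩ {x | w x ≤ M * s}) := by
        rw [ENNReal.tsum_mul_left, measure_biUnion hucount
          (hdisj.mono fun x => inter_subset_left) hmeas]
    _ ≤ _ := by
        gcongr
        refine iUnion₂_subset fun x hx y hy => ⟨hsubA x (huA hx) hy.1, fun h => ?_⟩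
        exact absurd (show M * s < w y from h.2) (not_lt.2 hy.2)

/-- A nonnegative supersolution that is small at one point of a ball is comparably small on more
than half of the ball. -/
theorem exists_hausdorffMeasure_superlevel_lt_half {κ : ℝ} (hκ : 0 < κ) (n : ℕ) :
    ∃ K : ℝ, 1 ≤ K ∧ ∀ {c : Euc n} {ρ s : ℝ} {w : Euc n → ℝ}, 0 < ρ →
      0 < s → QuadSupersol κ (closedBall c ((12 * κ + 23) * ρ)) w →
      LowerSemicontinuousOn w (closedBall c ((12 * κ + 23) * ρ)) →
      (∀ x ∈ closedBall c ((12 * κ + 23) * ρ), 0 ≤ w x) →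
      (∃ x ∈ closedBall c ρ, w x ≤ s) →
      (Measure.hausdorffMeasure (n : ℝ)).real (closedBall c ρ ∩ {x | K * s < w x}) <
        1 / 2 * (Measure.hausdorffMeasure (n : ℝ)).real (closedBall c ρ) := by
  obtain ⟨M, hM, Q, hQ, hstep⟩ := exists_hausdorffMeasure_superlevel_le hκ n
  have hQ1 : (1 : ℝ) ≤ Q := by exact_mod_cast hQ
  have hq0 : 0 ≤ 1 - 1 / (Q : ℝ) := by
    rw [sub_nonneg, div_le_one (by linarith)]
    exact hQ1
  have hq1 : 1 - 1 / (Q : ℝ) < 1 := by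
    have : 0 < 1 / (Q : ℝ) := by positivity
    linarith
  obtain ⟨k, hk⟩ := exists_pow_lt_of_lt_one (show (0 : ℝ) < 1 / 2 by norm_num) hq1
  refine ⟨M ^ k, one_le_pow₀ hM, ?_⟩
  rintro c ρ s w hρ hs hw hlsc hnn ⟨x₁, hx₁, hx₁s⟩
  have hρR : closedBall c ρ ⊆ closedBall c ((12 * κ + 23) * ρ) :=
    closedBall_subset_closedBall (by nlinarith)
  set μ : Measure (Euc n) := Measure.hausdorffMeasure (n : ℝ) with hμ
  have hfin : μ (closedBall c ρ) ≠ ⊤ := measure_closedBall_lt_top.ne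
  have hmeas : ∀ t : ℝ, MeasurableSet (closedBall c ρ ∩ {x | t < w x}) := by
    intro t
    have h1 : closedBall c ρ ∩ {x | t < w x} =
        closedBall c ρ \ (closedBall c ρ ∩ {x | w x ≤ t}) := by
      ext x; simp
    rw [h1]
    exact measurableSet_closedBall.diff ((hlsc.mono hρR).isCompact_inter_preimage_Iic
      (isCompact_closedBall c ρ) t).isClosed.measurableSet
  have hind : ∀ j : ℕ, μ.real (closedBall c ρ ∩ {x | M ^ j * s < w x}) ≤
      (1 - 1 / (Q : ℝ)) ^ j * μ.real (closedBall c ρ) := by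
    intro j
    induction j with
    | zero =>
      rw [pow_zero, one_mul, pow_zero, one_mul]
      exact measureReal_mono inter_subset_left hfin
    | succ j ih =>
      have hMj : 1 ≤ M ^ j := one_le_pow₀ hM
      have h1 := hstep (s := M ^ j * s) hρ (by positivity) hw hlsc hnn
        ⟨x₁, hx₁, hx₁s.trans (le_mul_of_one_le_left hs.le hMj)⟩
      rw [← mul_assoc, ← pow_succ'] at h1
      have hsub : closedBall c ρ ∩ {x | M ^ (j + 1) * s < w x} ⊆
          closedBall c ρ ∩ {x | M ^ j * s < w x} := by
        refine inter_subset_inter_right _ fun x hx => ?_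
        refine lt_of_le_of_lt ?_ (mem_ofPred_eq ▸ hx)
        gcongr
        omega
      have h2 : μ.real (closedBall c ρ ∩ {x | M ^ j * s < w x}) ≤
          Q * (μ.real (closedBall c ρ ∩ {x | M ^ j * s < w x}) -
            μ.real (closedBall c ρ ∩ {x | M ^ (j + 1) * s < w x})) := by
        rw [← measureReal_sdiff hsub (hmeas _)]
        have hfin' : μ ((closedBall c ρ ∩ {x | M ^ j * s < w x}) \
            (closedBall c ρ ∩ {x | M ^ (j + 1) * s < w x})) ≠ ⊤ :=
          measure_ne_top_of_subset (sdiff_subset.trans inter_subset_left) hfin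
        have := ENNReal.toReal_mono (ENNReal.mul_ne_top ENNReal.coe_ne_top hfin') h1
        rwa [ENNReal.toReal_mul] at this
      have h3 : μ.real (closedBall c ρ ∩ {x | M ^ (j + 1) * s < w x}) ≤
          (1 - 1 / (Q : ℝ)) * μ.real (closedBall c ρ ∩ {x | M ^ j * s < w x}) := by
        rw [← div_le_iff₀' (by linarith)] at h2
        rw [sub_mul, one_mul, one_div_mul_eq_div]
        linarith
      calc _ ≤ _ := h3
        _ ≤ (1 - 1 / (Q : ℝ)) * ((1 - 1 / (Q : ℝ)) ^ j * μ.real (closedBall c ρ)) := by gcongr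
        _ = _ := by ring
  refine (hind k).trans_lt (mul_lt_mul_of_pos_right hk ?_)
  exact ENNReal.toReal_pos (measure_closedBall_pos μ c hρ).ne' hfin

/-- A nonnegative supersolution `w` that is small somewhere in a ball and a nonnegative
supersolution `v` that is small at its centre are simultaneously small at some point. -/
theorem exists_le_and_le_of_quadSupersol {κ : ℝ} (hκ : 0 < κ) (n : ℕ) :
    ∃ K : ℝ, 1 ≤ K ∧ ∀ {x : Euc n} {d s t : ℝ} {w v : Euc n → ℝ}, 0 < d → 0 < s → 0 < t →
      QuadSupersol κ (closedBall x (2 * d)) w →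
      LowerSemicontinuousOn w (closedBall x (2 * d)) →
      (∀ y ∈ closedBall x (2 * d), 0 ≤ w y) →
      (∃ z ∈ closedBall x d, w z ≤ t) →
      QuadSupersol κ (closedBall x (d / 2)) v →
      LowerSemicontinuousOn v (closedBall x (d / 2)) →
      (∀ y ∈ closedBall x (d / 2), 0 ≤ v y) → v x ≤ s →
      ∃ y ∈ closedBall x (d / 2), w y ≤ K * t ∧ v y ≤ K * s := by
  obtain ⟨L, hL, hdens⟩ := exists_hausdorffMeasure_superlevel_lt_half hκ n
  set R := 12 * κ + 23 with hR
  obtain ⟨C, hC, hex⟩ := exists_le_of_le_of_quadSupersol hκ (m := 2 * R) (by linarith)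
  refine ⟨L * C, one_le_mul_of_one_le_of_one_le hL hC, ?_⟩
  intro x d s t w v hd hs ht hw hwl hwn hz hv hvl hvn hvx
  have hR0 : 0 < R := by positivity
  have e1 : 2 * (2 * R) * (d / (2 * R)) = 2 * d := by field_simp
  have e2 : 2 * R * (d / (2 * R)) = d := by field_simp
  have e3 : R * (d / (2 * R)) = d / 2 := by field_simp
  have hρ : 0 < d / (2 * R) := by positivity
  have hρd : closedBall x (d / (2 * R)) ⊆ closedBall x (d / 2) := by
    refine closedBall_subset_closedBall ?_
    gcongr
    linarith
  have hsub : closedBall x (d / 2) ⊆ closedBall x (2 * d) :=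
    closedBall_subset_closedBall (by linarith)
  have hx₁ := hex (w := w) (c := x) hρ ht (by rwa [e1]) (by rwa [e1]) (by rwa [e1]) (by rwa [e2])
  have hW := hdens (w := w) (c := x) (s := C * t) hρ (by positivity)
    (by rw [e3]; exact hw.mono hsub) (by rw [e3]; exact hwl.mono hsub)
    (by rw [e3]; exact fun y hy => hwn y (hsub hy)) hx₁
  have hV := hdens (w := v) (c := x) (s := s) hρ hs (by rwa [e3]) (by rwa [e3]) (by rwa [e3])
    ⟨x, mem_closedBall_self hρ.le, hvx⟩
  by_contra! hcon
  set μ : Measure (Euc n) := Measure.hausdorffMeasure (n : ℝ) with hμ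
  have hfin : μ (closedBall x (d / (2 * R))) ≠ ⊤ := measure_closedBall_lt_top.ne
  have hcov : closedBall x (d / (2 * R)) ⊆
      (closedBall x (d / (2 * R)) ∩ {y | L * (C * t) < w y}) ∪
      (closedBall x (d / (2 * R)) ∩ {y | L * s < v y}) := by
    intro y hy
    by_cases h : L * (C * t) < w y
    · exact Or.inl ⟨hy, h⟩
    · refine Or.inr ⟨hy, lt_of_le_of_lt ?_ (hcon y (hρd hy) (by linarith))⟩
      rw [mul_assoc]
      gcongr
      exact le_mul_of_one_le_left hs.le hC
  have h1 := (measureReal_mono hcov (measure_ne_top_of_subset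
    (union_subset inter_subset_left inter_subset_left) hfin)).trans (measureReal_union_le _ _)
  linarith

theorem isOpen_setOf_lt_of_lowerSemicontinuousOn {X : Type*} [TopologicalSpace X] {Ω : Set X}
    {u φ : X → ℝ} (hΩ : IsOpen Ω) (hu : LowerSemicontinuousOn u Ω) (hφ : ContinuousOn φ Ω) :
    IsOpen {x ∈ Ω | φ x < u x} := by
  rw [isOpen_iff_mem_nhds]
  rintro x ⟨hx, hxu⟩
  have h := (hu.add hφ.neg.lowerSemicontinuousOn) x hx 0 (by simpa using hxu)
  rw [hΩ.nhdsWithin_eq hx] at h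
  filter_upwards [h, hΩ.mem_nhds hx] with y hy hyΩ
  refine ⟨hyΩ, ?_⟩
  simp at hy
  linarith

/-- Upper bounds for a solution of the obstacle problem at a contact point improve by a fixed
factor. -/
theorem exists_eventually_le_mul_of_eventually_le {n : ℕ} {lb ub : ℝ} (hlb : 0 < lb)
    (hle : lb ≤ ub) {F : Matrix (Fin n) (Fin n) ℝ → ℝ} (hF : UniformlyElliptic F lb ub)
    (hF0 : F 0 = 0) {Ω : Set (Euc n)} (hΩo : IsOpen Ω) {u φ : Euc n → ℝ}
    (hφc : ContinuousOn φ Ω) (hlsc : LowerSemicontinuousOn u Ω) (hobs : ∀ x ∈ Ω, φ x ≤ u x)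
    (hsuper : ViscSupersol F Ω u) (hcont : ContinuousOn u {x ∈ Ω | φ x < u x})
    (hsub : ViscSubsol F {x ∈ Ω | φ x < u x} u) :
    ∃ q : ℝ, 0 ≤ q ∧ q < 1 ∧ ∀ x₀ ∈ Ω, u x₀ = φ x₀ → ∀ H : ℝ, 0 < H →
      (∀ᶠ x in nhds x₀, u x ≤ φ x₀ + H) → ∀ᶠ x in nhds x₀, u x ≤ φ x₀ + q * H := by
  have hκ : 0 < ub / lb := div_pos (hlb.trans_le hle) hlb
  obtain ⟨K, hK, hhar⟩ := exists_le_and_le_of_quadSupersol hκ n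
  have hK0 : 0 < K := by linarith
  have hK2 : 1 / (2 * K) ≤ 1 / 2 := by gcongr; linarith
  have hK3 : 0 < 1 / (2 * K) := by positivity
  refine ⟨1 - 1 / (2 * K), by linarith, by linarith, ?_⟩
  intro x₀ hx₀ hx₀u H hH hev
  set δ := H / (8 * K) with hδ
  have hδ0 : 0 < δ := by positivity
  have hδK : K * δ = H / 8 := by rw [hδ]; field_simp
  have hδH : δ ≤ H / 8 := by rw [← hδK]; exact le_mul_of_one_le_left hδ0.le hK
  have hΩn := hΩo.mem_nhds hx₀
  have hev1 : ∀ᶠ x in nhds x₀, φ x₀ - δ < u x := by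
    have := hlsc x₀ hx₀ (φ x₀ - δ) (by linarith)
    rwa [hΩo.nhdsWithin_eq hx₀] at this
  have hev2 : ∀ᶠ x in nhds x₀, φ x < φ x₀ + δ :=
    (hφc.continuousAt hΩn).eventually_lt_const (by linarith)
  obtain ⟨r, hr, hball⟩ := Metric.eventually_nhds_iff_ball.1
    (hev.and (hev1.and (hev2.and hΩn)))
  have hhalf : closedBall x₀ (r / 2) ⊆ Ω := fun y hy =>
    (hball y (closedBall_subset_ball (by linarith) hy)).2.2.2
  have hZc : IsCompact (closedBall x₀ (r / 2) ∩ (fun x => u x + -φ x) ⁻¹' Iic 0) :=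
    ((hlsc.add hφc.neg.lowerSemicontinuousOn).mono hhalf).isCompact_inter_preimage_Iic
      (isCompact_closedBall _ _) 0
  filter_upwards [ball_mem_nhds x₀ (show 0 < r / 4 by linarith)] with x hx
  rw [mem_ball] at hx
  have hxr : x ∈ closedBall x₀ (r / 2) := mem_closedBall.2 (by linarith)
  have hxΩ := hhalf hxr
  rcases (hobs x hxΩ).eq_or_lt with hxu | hxu
  · have h1 := (hball x (mem_ball.2 (by linarith))).2.2.1
    have h2 : 1 / (2 * K) * H ≤ 1 / 2 * H := by gcongr
    linarith
  obtain ⟨z, hzZ, hzd⟩ := hZc.exists_infDist_eq_dist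
    ⟨x₀, mem_closedBall_self (by linarith), by simp [hx₀u]⟩ x
  have hzu : u z + -φ z ≤ 0 := hzZ.2
  set d := dist x z with hd
  have hd0 : 0 < d := by
    refine dist_pos.2 fun h => ?_
    rw [← h] at hzu
    linarith
  have hdx : d ≤ dist x x₀ := by
    rw [← hzd]
    exact infDist_le_dist_of_mem ⟨mem_closedBall_self (by linarith), by simp [hx₀u]⟩
  have hfree : closedBall x (d / 2) ⊆ {y ∈ Ω | φ y < u y} := by
    intro y hy
    rw [mem_closedBall] at hy
    have hyr : y ∈ closedBall x₀ (r / 2) := by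
      have := dist_triangle y x x₀
      exact mem_closedBall.2 (by linarith)
    refine ⟨hhalf hyr, ?_⟩
    by_contra! hcon
    have h1 := infDist_le_dist_of_mem (x := x) (show y ∈ closedBall x₀ (r / 2) ∩
      (fun x => u x + -φ x) ⁻¹' Iic 0 from ⟨hyr, by
        show u y + -φ y ≤ 0
        linarith⟩)
    rw [hzd, dist_comm] at h1
    linarith
  have h2d : closedBall x (2 * d) ⊆ ball x₀ r := fun y hy => by
    rw [mem_closedBall] at hy
    have := dist_triangle y x x₀
    exact mem_ball.2 (by linarith)
  have h2dΩ : closedBall x (2 * d) ⊆ Ω := fun y hy => (hball y (h2d hy)).2.2.2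
  by_contra! hcon
  obtain ⟨y, hy, hyw, hyv⟩ := hhar (x := x) (d := d) (s := 1 / (2 * K) * H) (t := 2 * δ)
    (w := fun y => u y + (δ - φ x₀)) (v := fun y => -u y + (φ x₀ + H)) hd0 (by positivity)
    (by positivity) (((hsuper.quadSupersol hlb hle hF hF0).mono h2dΩ).add_const _)
    ((hlsc.mono h2dΩ).add continuousOn_const.lowerSemicontinuousOn)
    (fun y hy => by
      have := (hball y (h2d hy)).2.1
      linarith)
    ⟨z, by rw [mem_closedBall, dist_comm], by
      have := (hball z (closedBall_subset_ball (by linarith) hzZ.1)).2.2.1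
      linarith⟩
    (((hsub.quadSupersol_neg hlb hle hF hF0).mono hfree).add_const _)
    ((hcont.mono hfree).neg.add continuousOn_const).lowerSemicontinuousOn
    (fun y hy => by
      have := (hball y (h2d (closedBall_subset_closedBall (by linarith) hy))).1
      linarith)
    (by linarith)
  have h3 : K * (1 / (2 * K) * H) = H / 2 := by field_simp
  rw [h3] at hyv
  linarith

/-- Evans' lemma. If the restriction of `u` to the contact set is
continuous, then `u` is continuous in all of `Ω`. -/
theorem obstacle_solution_continuous_of_continuous_on_contact_set
    (n : ℕ) (lb ub : ℝ) (hlb : 0 < lb) (hle : lb ≤ ub)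
    (F : Matrix (Fin n) (Fin n) ℝ → ℝ)
    (hF : UniformlyElliptic F lb ub) (hF0 : F 0 = 0)
    (Ω : Set (Euc n)) (hΩo : IsOpen Ω) (hΩb : Bornology.IsBounded Ω)
    (φ : Euc n → ℝ) (hφc : ContinuousOn φ Ω)
    (u : Euc n → ℝ)
    (hubd : ∃ B : ℝ, ∀ x ∈ Ω, |u x| ≤ B)
    (hlsc : LowerSemicontinuousOn u Ω)
    (hobs : ∀ x ∈ Ω, φ x ≤ u x)
    (hsuper : ViscSupersol F Ω u)
    (hcont : ContinuousOn u {x ∈ Ω | φ x < u x})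
    (hsol₁ : ViscSupersol F {x ∈ Ω | φ x < u x} u)
    (hsol₂ : ViscSubsol F {x ∈ Ω | φ x < u x} u)
    (hcontact : ContinuousOn u {x ∈ Ω | u x = φ x}) :
    ContinuousOn u Ω := by
  obtain ⟨q, hq0, hq1, himp⟩ := exists_eventually_le_mul_of_eventually_le hlb hle hF hF0 hΩo hφc
    hlsc hobs hsuper hcont hsol₂
  intro x₀ hx₀
  refine ContinuousAt.continuousWithinAt ?_
  rcases (hobs x₀ hx₀).eq_or_lt with hc | hc
  · obtain ⟨B, hB⟩ := hubd
    have hBφ : φ x₀ ≤ B := by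
      rw [hc]
      exact (abs_le.1 (hB x₀ hx₀)).2
    set H := B - φ x₀ + 1 with hH
    have hH0 : 0 < H := by linarith
    have hev : ∀ k : ℕ, ∀ᶠ x in nhds x₀, u x ≤ φ x₀ + q ^ k * H := by
      intro k
      induction k with
      | zero =>
        filter_upwards [hΩo.mem_nhds hx₀] with x hx
        have := (abs_le.1 (hB x hx)).2
        rw [pow_zero]
        linarith
      | succ k ih =>
        rcases (mul_nonneg (pow_nonneg hq0 k) hH0.le).eq_or_lt with h0 | h0
        · rwa [pow_succ', mul_assoc, ← h0, mul_zero, h0]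
        · rw [pow_succ', mul_assoc]
          exact himp x₀ hx₀ hc.symm _ h0 ih
    refine tendsto_order.2 ⟨fun a ha => ?_, fun a ha => ?_⟩
    · have := hlsc x₀ hx₀ a ha
      rwa [hΩo.nhdsWithin_eq hx₀] at this
    · obtain ⟨k, hk⟩ := exists_pow_lt_of_lt_one (div_pos (sub_pos.2 ha) hH0) hq1
      rw [lt_div_iff₀ hH0] at hk
      filter_upwards [hev k] with x hx
      linarith
  · exact hcont.continuousAt
      ((isOpen_setOf_lt_of_lowerSemicontinuousOn hΩo hlsc hφc).mem_nhds ⟨hx₀, hc⟩)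
end
end

section
/- Let Ω ⊂ ℝⁿ be open, let φ be semiconvex on Ω with nondecreasing modulus of semiconvexity ω, and let u ∈ C(Ω) satisfy u ≥ φ in Ω, be superharmonic in Ω in the sense that u(x₀) ≥ ⨍_{B_s(x₀)} u dy for every ball B_s(x₀) with closure in Ω, and be harmonic (C² with Δu = 0) in the open set {u > φ}. Fix x₁ ∈ {u > φ} and let x₀ ∈ {u = φ} be a closest contact point, i.e. ρ := |x₁ − x₀| = dist(x₁, {u = φ}), and assume B_{2ρ}(x₀) ⊂ Ω. Then there is a dimensional constant C(n) > 0 such that u(x₁) − L_{x₀}(x₁) ≤ C(n)·ω(2ρ), where L_{x₀} is a linear part of φ at x₀. -/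
open MeasureTheory Metric Set
open scoped RealInnerProductSpace

noncomputable section

/-- The truncated paraboloid `(1 - |y|²)₊`, used as an averaging kernel. -/
def parabolicCap {n : ℕ} (y : Euc n) : ℝ := max 0 (1 - ‖y‖ ^ 2)

lemma parabolicCap_nonneg {n : ℕ} (y : Euc n) : 0 ≤ parabolicCap y := le_max_left _ _

lemma parabolicCap_le_one {n : ℕ} (y : Euc n) : parabolicCap y ≤ 1 :=
  max_le zero_le_one (by nlinarith [sq_nonneg ‖y‖])

lemma parabolicCap_eq_zero {n : ℕ} {y : Euc n} (hy : 1 ≤ ‖y‖) : parabolicCap y = 0 :=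
  max_eq_left (by nlinarith)

lemma continuous_parabolicCap {n : ℕ} : Continuous (parabolicCap : Euc n → ℝ) := by
  unfold parabolicCap; fun_prop

lemma hasCompactSupport_parabolicCap {n : ℕ} :
    HasCompactSupport (parabolicCap : Euc n → ℝ) := by
  refine HasCompactSupport.intro (isCompact_closedBall (0 : Euc n) 1) fun y hy => ?_
  refine parabolicCap_eq_zero ?_
  simp only [mem_closedBall, dist_zero_right, not_le] at hy
  exact hy.le

lemma integral_parabolicCap_pos (n : ℕ) : 0 < ∫ y : Euc n, parabolicCap y :=
  continuous_parabolicCap.integral_pos_of_hasCompactSupport_nonneg_nonzero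
    hasCompactSupport_parabolicCap parabolicCap_nonneg (x := 0) (by simp [parabolicCap])

lemma hasDerivAt_sq_max_zero (t : ℝ) :
    HasDerivAt (fun t : ℝ => (max 0 t) ^ 2) (2 * max 0 t) t := by
  have key : ∀ y : ℝ, y ≠ 0 → HasDerivAt (fun t : ℝ => (max 0 t) ^ 2) (2 * max 0 y) y := by
    intro y hy
    rcases lt_or_gt_of_ne hy with h | h
    · have : (fun t : ℝ => (max 0 t) ^ 2) =ᶠ[nhds y] fun _ => (0 : ℝ) := by
        filter_upwards [Iio_mem_nhds h] with s hs
        simp [max_eq_left (le_of_lt (mem_Iio.1 hs))]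
      rw [max_eq_left h.le, mul_zero]
      exact (hasDerivAt_const y (0 : ℝ)).congr_of_eventuallyEq this
    · have : (fun t : ℝ => (max 0 t) ^ 2) =ᶠ[nhds y] fun t => t ^ 2 := by
        filter_upwards [Ioi_mem_nhds h] with s hs
        rw [max_eq_right (le_of_lt (mem_Ioi.1 hs))]
      rw [max_eq_right h.le]
      simpa using (hasDerivAt_pow 2 y).congr_of_eventuallyEq this
  rcases eq_or_ne t 0 with rfl | ht
  · exact hasDerivAt_of_hasDerivAt_of_ne (g := fun t => 2 * max 0 t) key
      (by fun_prop) (by fun_prop)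
  · exact key t ht

lemma hasFDerivAt_sq_parabolicCap {n : ℕ} (y : Euc n) :
    HasFDerivAt (fun y : Euc n => parabolicCap y ^ 2)
      ((-4 * parabolicCap y) • innerSL ℝ y) y := by
  have h1 : HasFDerivAt (fun y : Euc n => 1 - ‖y‖ ^ 2) (-(2 • innerSL ℝ y)) y :=
    (hasStrictFDerivAt_norm_sq y).hasFDerivAt.const_sub 1
  have h2 := (hasDerivAt_sq_max_zero (1 - ‖y‖ ^ 2)).comp_hasFDerivAt y h1
  refine h2.congr_fderiv ?_
  ext v
  simp [parabolicCap]
  ring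

/-- Radial averages against the cap are stationary as long as the Laplacian vanishes. -/
lemma integral_cap_mul_radial_deriv_eq_zero {n : ℕ} {f : Euc n → ℝ} (hf : ContDiff ℝ 2 f)
    {x : Euc n} {R r : ℝ} (hr0 : 0 ≤ r) (hrR : r ≤ R)
    (hΔ : ∀ z ∈ ball x R, Matrix.trace (hess2 f z) = 0) :
    ∫ y, parabolicCap y * fderiv ℝ f (x + r • y) y = 0 := by
  have hf1 : ContDiff ℝ 1 (fderiv ℝ f) := hf.fderiv_right (by norm_num)
  set e : Fin n → Euc n := fun i => EuclideanSpace.single i 1 with he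
  have hd : ∀ i (y : Euc n), HasFDerivAt (fun y => fderiv ℝ f (x + r • y) (e i))
      (((ContinuousLinearMap.apply ℝ ℝ (e i)).comp (fderiv ℝ (fderiv ℝ f) (x + r • y))).comp
        (r • ContinuousLinearMap.id ℝ (Euc n))) y := by
    intro i y
    have h1 : HasFDerivAt (fun y : Euc n => x + r • y)
        (r • ContinuousLinearMap.id ℝ (Euc n)) y :=
      ((hasFDerivAt_id y).const_smul r).const_add x
    have h2 : HasFDerivAt (fderiv ℝ f) (fderiv ℝ (fderiv ℝ f) (x + r • y)) (x + r • y) :=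
      (hf1.differentiable (by norm_num) _).hasFDerivAt
    exact ((ContinuousLinearMap.apply ℝ ℝ (e i)).hasFDerivAt.comp _ h2).comp y h1
  have hcap : ∀ i (y : Euc n), fderiv ℝ (fun y : Euc n => parabolicCap y ^ 2) y (e i)
      = -4 * parabolicCap y * y i := by
    intro i y
    rw [(hasFDerivAt_sq_parabolicCap y).fderiv]
    have : ⟪y, e i⟫ = y i := by simp [he, EuclideanSpace.inner_single_right]
    simp [this]
  have hdc : ∀ i, Continuous fun y : Euc n => fderiv ℝ f (x + r • y) (e i) := by
    intro i
    have := hf1.continuous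
    fun_prop
  have hddc : ∀ i, Continuous fun y : Euc n =>
      fderiv ℝ (fun y => fderiv ℝ f (x + r • y) (e i)) y (e i) := by
    intro i
    have := hf1.continuous_fderiv (by norm_num)
    simp_rw [fun y => (hd i y).fderiv]
    simp only [ContinuousLinearMap.comp_apply, ContinuousLinearMap.apply_apply,
      smul_apply, ContinuousLinearMap.id_apply]
    fun_prop
  have hcc := continuous_parabolicCap (n := n)
  have hcs := hasCompactSupport_parabolicCap (n := n)
  have hcs2 : HasCompactSupport fun y : Euc n => parabolicCap y ^ 2 := by
    simp_rw [pow_two]; exact hcs.mul_left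
  have int1 : ∀ i, Integrable fun y : Euc n =>
      parabolicCap y * (y i * fderiv ℝ f (x + r • y) (e i)) := fun i =>
    Continuous.integrable_of_hasCompactSupport
      (by have := hdc i; fun_prop) hcs.mul_right
  have int2 : ∀ i, Integrable fun y : Euc n =>
      parabolicCap y ^ 2 * fderiv ℝ (fun y => fderiv ℝ f (x + r • y) (e i)) y (e i) := fun i =>
    Continuous.integrable_of_hasCompactSupport
      (by have := hddc i; fun_prop) hcs2.mul_right
  have int3 : ∀ i, Integrable fun y : Euc n =>
      parabolicCap y ^ 2 * fderiv ℝ f (x + r • y) (e i) := fun i =>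
    Continuous.integrable_of_hasCompactSupport
      (by have := hdc i; fun_prop) hcs2.mul_right
  have parts : ∀ i, 4 * ∫ y : Euc n, parabolicCap y * (y i * fderiv ℝ f (x + r • y) (e i))
      = ∫ y : Euc n,
        parabolicCap y ^ 2 * fderiv ℝ (fun y => fderiv ℝ f (x + r • y) (e i)) y (e i) := by
    intro i
    rw [integral_mul_fderiv_eq_neg_fderiv_mul_of_integrable _ (int2 i) (int3 i)
      (fun y _ => (hasFDerivAt_sq_parabolicCap y).differentiableAt)
      (fun y _ => (hd i y).differentiableAt), ← integral_const_mul, ← integral_neg]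
    · refine integral_congr_ae (Filter.Eventually.of_forall fun y => ?_)
      simp only [hcap]; ring
    · refine ((int1 i).const_mul (-4)).congr (Filter.Eventually.of_forall fun y => ?_)
      simp only [hcap]; ring
  have split : ∀ y : Euc n, parabolicCap y * fderiv ℝ f (x + r • y) y
      = ∑ i, parabolicCap y * (y i * fderiv ℝ f (x + r • y) (e i)) := by
    intro y
    rw [← Finset.mul_sum]
    congr 1
    have hy : y = ∑ i, y i • e i := by
      simpa [he] using ((EuclideanSpace.basisFun (Fin n) ℝ).sum_repr y).symm
    refine (congrArg (fderiv ℝ f (x + r • y)) hy).trans ?_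
    simp only [map_sum, map_smul, smul_eq_mul]
  have hzero : ∀ y : Euc n, ∑ i, parabolicCap y ^ 2 *
      fderiv ℝ (fun y => fderiv ℝ f (x + r • y) (e i)) y (e i) = 0 := by
    intro y
    rw [← Finset.mul_sum]
    rcases le_or_gt 1 ‖y‖ with h | h
    · simp [parabolicCap_eq_zero h]
    · rcases hr0.eq_or_lt with rfl | hr
      · simp
      have hmem : x + r • y ∈ ball x R := by
        rw [mem_ball, dist_eq_norm, add_sub_cancel_left, norm_smul, Real.norm_of_nonneg hr0]
        nlinarith [norm_nonneg y]
      have ht := hΔ _ hmem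
      simp only [Matrix.trace, Matrix.diag, hess2, iteratedFDeriv_two_apply] at ht
      simp only [fun i => (hd i y).fderiv]
      simp only [ContinuousLinearMap.comp_apply, ContinuousLinearMap.apply_apply,
        smul_apply, ContinuousLinearMap.id_apply, map_smul, smul_eq_mul]
      rw [← Finset.mul_sum]
      simp only [Matrix.cons_val_zero, Matrix.cons_val_one] at ht
      rw [ht]; simp
  have : 4 * ∫ y, parabolicCap y * fderiv ℝ f (x + r • y) y = 0 := by
    simp_rw [split]
    rw [integral_finsetSum _ fun i _ => int1 i, Finset.mul_sum]
    simp_rw [parts]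
    rw [← integral_finsetSum _ fun i _ => int2 i]
    simp_rw [hzero]
    simp
  linarith

/-- Mean value property weighted by the cap, for compactly supported `C²` functions that are
harmonic in a ball. -/
lemma integral_cap_mul_comp_eq {n : ℕ} {f : Euc n → ℝ} (hf : ContDiff ℝ 2 f)
    (hfc : HasCompactSupport f) {x : Euc n} {R : ℝ} (hR : 0 ≤ R)
    (hΔ : ∀ z ∈ ball x R, Matrix.trace (hess2 f z) = 0) :
    ∫ y, parabolicCap y * f (x + R • y) = f x * ∫ y : Euc n, parabolicCap y := by
  have hcc := continuous_parabolicCap (n := n)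
  have hcs := hasCompactSupport_parabolicCap (n := n)
  have hfcont := hf.continuous
  have hf'c : Continuous (fderiv ℝ f) := hf.continuous_fderiv (by norm_num)
  obtain ⟨K, hK⟩ := (hfc.fderiv ℝ).exists_bound_of_continuous hf'c
  have hderiv : ∀ r : ℝ, HasDerivAt (fun r => ∫ y, parabolicCap y * f (x + r • y))
      (∫ y, parabolicCap y * fderiv ℝ f (x + r • y) y) r := by
    intro r
    refine (hasDerivAt_integral_of_dominated_loc_of_deriv_le
      (F := fun (r : ℝ) (y : Euc n) => parabolicCap y * f (x + r • y))
      (F' := fun (r : ℝ) (y : Euc n) => parabolicCap y * fderiv ℝ f (x + r • y) y)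
      (bound := fun y => parabolicCap y * (K * ‖y‖)) (s := univ)
      Filter.univ_mem ?_ ?_ ?_ ?_ ?_ ?_).2
    · refine Filter.Eventually.of_forall fun s => Continuous.aestronglyMeasurable ?_
      fun_prop
    · exact Continuous.integrable_of_hasCompactSupport (by fun_prop) hcs.mul_right
    · exact Continuous.aestronglyMeasurable (by fun_prop)
    · refine Filter.Eventually.of_forall fun y s _ => ?_
      rw [norm_mul, Real.norm_of_nonneg (parabolicCap_nonneg y)]
      exact mul_le_mul_of_nonneg_left
        ((ContinuousLinearMap.le_opNorm _ _).trans
          (mul_le_mul_of_nonneg_right (hK _) (norm_nonneg _))) (parabolicCap_nonneg y)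
    · exact Continuous.integrable_of_hasCompactSupport (by fun_prop) hcs.mul_right
    · refine Filter.Eventually.of_forall fun y s _ => HasDerivAt.const_mul _ ?_
      have h1 : HasDerivAt (fun s : ℝ => x + s • y) y s := by
        simpa using ((hasDerivAt_id s).smul_const y).const_add x
      exact ((hf.differentiable (by norm_num) _).hasFDerivAt.comp_hasDerivAt s h1)
  have := constant_of_has_deriv_right_zero (a := 0) (b := R)
    (f := fun r => ∫ y, parabolicCap y * f (x + r • y))
    (fun r _ => (hderiv r).continuousAt.continuousWithinAt)
    (fun r hr => by
      have h := hderiv r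
      rw [integral_cap_mul_radial_deriv_eq_zero hf hr.1 hr.2.le hΔ] at h
      exact h.hasDerivWithinAt) R ⟨hR, le_rfl⟩
  simp only [zero_smul, add_zero] at this
  rw [this, integral_mul_const, mul_comm]

/-- Local version of the cap mean value property. -/
lemma integral_cap_mul_comp_eq_of_contDiffAt {n : ℕ} {f : Euc n → ℝ} {x : Euc n} {R S : ℝ}
    (hR : 0 < R) (hRS : R < S) (hf : ∀ z ∈ ball x S, ContDiffAt ℝ 2 f z)
    (hΔ : ∀ z ∈ ball x S, Matrix.trace (hess2 f z) = 0) :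
    ∫ y, parabolicCap y * f (x + R • y) = f x * ∫ y : Euc n, parabolicCap y := by
  let χ : ContDiffBump x := ⟨R, (R + S) / 2, hR, by linarith⟩
  have hχ : ∀ z ∈ ball x R, (fun z => χ z * f z) =ᶠ[nhds z] f := by
    intro z hz
    filter_upwards [isOpen_ball.mem_nhds hz] with w hw
    rw [χ.one_of_mem_closedBall (ball_subset_closedBall hw), one_mul]
  have hs : HasCompactSupport fun z => χ z * f z := χ.hasCompactSupport.mul_right
  have hsm : ContDiff ℝ 2 fun z => χ z * f z := by
    rw [contDiff_iff_contDiffAt]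
    intro z
    by_cases hz : z ∈ ball x S
    · exact χ.contDiff.contDiffAt.mul (hf z hz)
    · have hz' : z ∉ tsupport χ := by
        rw [χ.tsupport_eq]
        intro h
        have h' : dist z x ≤ (R + S) / 2 := h
        exact hz (mem_ball.2 (by linarith))
      have h0 : (fun z => χ z * f z) =ᶠ[nhds z] fun _ => 0 := by
        filter_upwards [(isClosed_tsupport χ).isOpen_compl.mem_nhds hz'] with w hw
        rw [image_eq_zero_of_notMem_tsupport hw, zero_mul]
      exact contDiffAt_const.congr_of_eventuallyEq h0
  have key := integral_cap_mul_comp_eq hsm hs hR.le (x := x) fun z hz => by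
    have : hess2 (fun z => χ z * f z) z = hess2 f z := by
      unfold hess2
      rw [(hχ z hz).iteratedFDeriv ℝ 2 |>.eq_of_nhds]
    rw [this]
    exact hΔ z (ball_subset_ball hRS.le hz)
  rw [χ.one_of_mem_closedBall (mem_closedBall_self hR.le), one_mul] at key
  rw [← key]
  refine integral_congr_ae (Filter.Eventually.of_forall fun y => ?_)
  rcases le_or_gt 1 ‖y‖ with h | h
  · simp [parabolicCap_eq_zero h]
  · have hmem : x + R • y ∈ closedBall x R := by
      rw [mem_closedBall, dist_eq_norm, add_sub_cancel_left, norm_smul, Real.norm_of_nonneg hR.le]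
      nlinarith [norm_nonneg y]
    simp only [χ.one_of_mem_closedBall hmem, one_mul]

/-- A nonnegative function which is harmonic in `ball x S` is bounded at the centre by its
integral over a smaller concentric ball. -/
lemma mul_integral_cap_le_setIntegral {n : ℕ} {v : Euc n → ℝ} {x : Euc n} {R S : ℝ}
    (hR : 0 < R) (hRS : R < S) (hv : ∀ z ∈ ball x S, ContDiffAt ℝ 2 v z)
    (hΔ : ∀ z ∈ ball x S, Matrix.trace (hess2 v z) = 0) (h0 : ∀ z ∈ ball x R, 0 ≤ v z) :
    v x * ∫ y : Euc n, parabolicCap y ≤ (R ^ n)⁻¹ * ∫ z in ball x R, v z := by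
  rw [← integral_cap_mul_comp_eq_of_contDiffAt hR hRS hv hΔ]
  have hint : IntegrableOn v (ball x R) :=
    (ContinuousOn.integrableOn_compact (isCompact_closedBall x R) fun z hz =>
      (hv z (closedBall_subset_ball hRS hz)).continuousAt.continuousWithinAt).mono_set
      ball_subset_closedBall
  set w : Euc n → ℝ := (ball x R).indicator v with hw
  have hwint : Integrable w := (integrable_indicator_iff measurableSet_ball).2 hint
  have hscale : ∫ y, w (x + R • y) = (R ^ n)⁻¹ * ∫ z in ball x R, v z := by
    rw [Measure.integral_comp_smul volume (fun z => w (x + z)) R,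
      integral_add_left_eq_self w x, hw, integral_indicator measurableSet_ball,
      finrank_euclideanSpace_fin, abs_of_pos (by positivity), smul_eq_mul]
  rw [← hscale]
  have hmem : ∀ y : Euc n, ‖y‖ < 1 → x + R • y ∈ ball x R := fun y h => by
    rw [mem_ball, dist_eq_norm, add_sub_cancel_left, norm_smul, Real.norm_of_nonneg hR.le]
    exact mul_lt_of_lt_one_right hR h
  refine integral_mono_of_nonneg (Filter.Eventually.of_forall fun y => ?_)
    ((hwint.comp_add_left x).comp_smul hR.ne') (Filter.Eventually.of_forall fun y => ?_)
  · rcases le_or_gt 1 ‖y‖ with h | h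
    · simp [parabolicCap_eq_zero h]
    · exact mul_nonneg (parabolicCap_nonneg y) (h0 _ (hmem y h))
  · rcases le_or_gt 1 ‖y‖ with h | h
    · simp only [parabolicCap_eq_zero h, zero_mul]
      exact indicator_nonneg h0 _
    · simp only [hw, indicator_of_mem (hmem y h)]
      exact mul_le_of_le_one_left (h0 _ (hmem y h)) (parabolicCap_le_one y)

/-- A linear function centred at `x` has zero integral over balls about `x`. -/
lemma setIntegral_ball_inner_sub_eq_zero {n : ℕ} (x p : Euc n) (s : ℝ) :
    ∫ y in ball x s, ⟪p, y - x⟫ = 0 := by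
  set h : Euc n → ℝ := (ball x s).indicator fun y => ⟪p, y - x⟫ with hh
  have hodd : ∀ y, h ((2 : ℝ) • x - y) = -h y := by
    intro y
    have hsub : (2 : ℝ) • x - y - x = -(y - x) := by rw [two_smul]; abel
    have hmem : (2 : ℝ) • x - y ∈ ball x s ↔ y ∈ ball x s := by
      rw [mem_ball, mem_ball, dist_eq_norm, dist_eq_norm, hsub, norm_neg]
    by_cases hy : y ∈ ball x s
    · rw [hh, indicator_of_mem (hmem.2 hy), indicator_of_mem hy, hsub, inner_neg_right]
    · rw [hh, indicator_of_notMem (mt hmem.1 hy), indicator_of_notMem hy, neg_zero]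
  have key := integral_sub_left_eq_self h volume ((2 : ℝ) • x)
  simp_rw [hodd, integral_neg] at key
  rw [← integral_indicator measurableSet_ball]
  linarith

lemma contDiffAt_sub_affine {n : ℕ} {u : Euc n → ℝ} {z : Euc n} (hu : ContDiffAt ℝ 2 u z)
    (x p : Euc n) (c : ℝ) : ContDiffAt ℝ 2 (fun y => u y - (c + ⟪p, y - x⟫)) z :=
  hu.sub (contDiffAt_const.add
    ((innerSL ℝ p).contDiff.contDiffAt.comp z (contDiffAt_id.sub contDiffAt_const)))

/-- Subtracting an affine function does not change the Hessian. -/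
lemma hess2_sub_affine {n : ℕ} {u : Euc n → ℝ} {z : Euc n} (hu : ContDiffAt ℝ 2 u z)
    (x p : Euc n) (c : ℝ) :
    hess2 (fun y => u y - (c + ⟪p, y - x⟫)) z = hess2 u z := by
  have haff : ∀ y, HasFDerivAt (fun y : Euc n => c + ⟪p, y - x⟫) (innerSL ℝ p) y := fun y => by
    simpa using (((innerSL ℝ p).hasFDerivAt (x := y - x)).comp y
      ((hasFDerivAt_id y).sub_const x)).const_add c
  have hev : fderiv ℝ (fun y => u y - (c + ⟪p, y - x⟫)) =ᶠ[nhds z]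
      fun y => fderiv ℝ u y - innerSL ℝ p := by
    filter_upwards [hu.eventually (by simp)] with y hy
    exact ((hy.differentiableAt (by norm_num)).hasFDerivAt.sub (haff y)).fderiv
  ext i j
  simp only [hess2, iteratedFDeriv_two_apply]
  rw [hev.fderiv_eq, fderiv_sub_const]

/-- For the Laplacian: the growth of `u` above a linear part of the
obstacle at a closest contact point is controlled by the modulus of semiconvexity,
with a dimensional constant. -/
theorem laplacian_growth_above_linear_part
    (n : ℕ) :
    ∃ C > 0, ∀ (Ω : Set (Euc n)) (φ u : Euc n → ℝ) (ω : ℝ → ℝ) (x₀ x₁ p : Euc n),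
      IsOpen Ω → IsModulus ω →
      SemiconvexWithModulus Ω φ ω →
      ContinuousOn u Ω →
      (∀ x ∈ Ω, φ x ≤ u x) →
      -- superharmonicity via the sub-mean-value property on balls
      (∀ x : Euc n, ∀ s : ℝ, 0 < s → closure (ball x s) ⊆ Ω →
        (⨍ y in ball x s, u y) ≤ u x) →
      -- `u` is harmonic (C² with `Δu = 0`) in the non-contact set
      (∀ x ∈ {x ∈ Ω | φ x < u x}, ContDiffAt ℝ 2 u x ∧ Matrix.trace (hess2 u x) = 0) →
      x₁ ∈ Ω → φ x₁ < u x₁ →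
      x₀ ∈ Ω → u x₀ = φ x₀ →
      -- `x₀` is a closest contact point to `x₁`
      (∀ y ∈ Ω, u y = φ y → ‖x₁ - x₀‖ ≤ ‖x₁ - y‖) →
      ball x₀ (2 * ‖x₁ - x₀‖) ⊆ Ω →
      IsLinearPartSlope Ω φ ω x₀ p →
      u x₁ - (φ x₀ + ⟪p, x₁ - x₀⟫) ≤ C * ω (2 * ‖x₁ - x₀‖) := by
  have hA := integral_parabolicCap_pos n
  have hB : 0 < volume.real (ball (0 : Euc n) 1) :=
    ENNReal.toReal_pos (measure_ball_pos volume _ one_pos).ne' measure_ball_lt_top.ne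
  refine ⟨3 ^ n * volume.real (ball (0 : Euc n) 1) / ∫ y : Euc n, parabolicCap y,
    by positivity, ?_⟩
  intro Ω φ u ω x₀ x₁ p hΩ hω _ hu hφu hsuper hharm hx₁ hx₁u hx₀ hx₀u hclosest hball hp
  set ρ := ‖x₁ - x₀‖ with hρ
  have hρ0 : 0 < ρ := by
    refine norm_pos_iff.2 (sub_ne_zero.2 ?_)
    rintro rfl
    exact hx₁u.ne' hx₀u
  set W := ω (2 * ρ) with hW
  set r := ρ / 2 with hr
  have hr0 : 0 < r := by positivity
  set v : Euc n → ℝ := fun y => u y - (φ x₀ - W + ⟪p, y - x₀⟫) with hv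
  have hvnonneg : ∀ y ∈ ball x₀ (2 * ρ), 0 ≤ v y := by
    intro y hy
    have h1 := hp y (hball hy)
    have h2 := hφu y (hball hy)
    have h3 : ω ‖y - x₀‖ ≤ W :=
      hω.2.1 (norm_nonneg _) (by positivity : (0 : ℝ) ≤ 2 * ρ)
        (by rw [← dist_eq_norm]; exact (mem_ball.1 hy).le)
    simp only [hv]
    linarith
  have hsub : ball x₁ ρ ⊆ ball x₀ (2 * ρ) :=
    ball_subset_ball' (by rw [dist_eq_norm, ← hρ]; linarith)
  have hnc : ∀ y ∈ ball x₁ ρ, y ∈ {x ∈ Ω | φ x < u x} := by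
    intro y hy
    have hyΩ := hball (hsub hy)
    refine ⟨hyΩ, lt_of_le_of_ne (hφu y hyΩ) fun h => ?_⟩
    have h1 := hclosest y hyΩ h.symm
    rw [mem_ball', dist_eq_norm] at hy
    linarith
  have hcl : closedBall x₀ (3 * r) ⊆ Ω :=
    (closedBall_subset_ball (by linarith)).trans hball
  have hint : IntegrableOn u (ball x₀ (3 * r)) :=
    ((hu.mono hcl).integrableOn_compact (isCompact_closedBall _ _)).mono_set
      ball_subset_closedBall
  have hlin : IntegrableOn (fun y => ⟪p, y - x₀⟫) (ball x₀ (3 * r)) :=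
    (((innerSL ℝ p).continuous.comp
      (continuous_id.sub continuous_const)).continuousOn.integrableOn_compact
      (isCompact_closedBall x₀ (3 * r))).mono_set ball_subset_closedBall
  have hconst : IntegrableOn (fun _ : Euc n => φ x₀ - W) (ball x₀ (3 * r)) :=
    integrableOn_const measure_ball_lt_top.ne
  have hvint : IntegrableOn v (ball x₀ (3 * r)) := hint.sub (hconst.add hlin)
  have hvol : volume.real (ball x₀ (3 * r)) =
      (3 * r) ^ n * volume.real (ball (0 : Euc n) 1) := by
    rw [Measure.real, Measure.addHaar_ball_of_pos volume x₀ (by positivity : 0 < 3 * r),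
      ENNReal.toReal_mul, ENNReal.toReal_ofReal (by positivity), finrank_euclideanSpace_fin,
      Measure.real]
  have hmean : ∫ y in ball x₀ (3 * r), v y ≤ volume.real (ball x₀ (3 * r)) * W := by
    have h1 := hsuper x₀ (3 * r) (by positivity) ((closure_ball_subset_closedBall).trans hcl)
    have hvolpos : 0 < volume.real (ball x₀ (3 * r)) := by rw [hvol]; positivity
    rw [setAverage_eq, smul_eq_mul, inv_mul_le_iff₀ hvolpos, hx₀u] at h1
    have h2 : ∫ y in ball x₀ (3 * r), v y =
        (∫ y in ball x₀ (3 * r), u y) - ∫ y in ball x₀ (3 * r), (φ x₀ - W + ⟪p, y - x₀⟫) :=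
      integral_sub hint (hconst.add hlin)
    rw [h2, integral_add hconst hlin,
      setIntegral_ball_inner_sub_eq_zero, setIntegral_const, smul_eq_mul]
    linarith
  have hx₁v := mul_integral_cap_le_setIntegral (v := v) (x := x₁) hr0 (by linarith : r < ρ)
    (fun z hz => contDiffAt_sub_affine (hharm z (hnc z hz)).1 x₀ p _)
    (fun z hz => by
      rw [hv, hess2_sub_affine (hharm z (hnc z hz)).1]
      exact (hharm z (hnc z hz)).2)
    (fun z hz => hvnonneg z (hsub (ball_subset_ball (by linarith) hz)))
  have hmono : ∫ z in ball x₁ r, v z ≤ ∫ z in ball x₀ (3 * r), v z := by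
    refine setIntegral_mono_set hvint ?_ (LE.le.eventuallyLE
      (ball_subset_ball' (by rw [dist_eq_norm, ← hρ]; linarith)))
    filter_upwards [ae_restrict_mem measurableSet_ball] with z hz
    exact hvnonneg z (ball_subset_ball (by linarith) hz)
  have hW0 : 0 ≤ W := hω.2.2 _ (by positivity)
  have hfinal : v x₁ * ∫ y : Euc n, parabolicCap y ≤
      3 ^ n * volume.real (ball (0 : Euc n) 1) * W := by
    calc v x₁ * ∫ y : Euc n, parabolicCap y
        ≤ (r ^ n)⁻¹ * ((3 * r) ^ n * volume.real (ball (0 : Euc n) 1) * W) := by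
          refine hx₁v.trans (mul_le_mul_of_nonneg_left ?_ (by positivity))
          rw [← hvol]
          exact hmono.trans hmean
      _ = 3 ^ n * volume.real (ball (0 : Euc n) 1) * W := by
          rw [mul_pow]; field_simp
  have hvx : v x₁ ≤ 3 ^ n * volume.real (ball (0 : Euc n) 1) / (∫ y : Euc n, parabolicCap y)
      * W := by
    rw [div_mul_eq_mul_div, le_div_iff₀ hA]
    exact hfinal
  simp only [hv] at hvx
  linarith
end
end
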